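/- arXiv:2001.10522 — 7 statements merged into one kernel-verified Lean document; each statement's English description precedes it below -/
import Mathlib

section
/- Let a < b be real numbers and let f = (f₁, f₂) : [a,b] × [a,b] → ℝ² be a continuous map such that f₁(a, x₂) < 0 < f₁(b, x₂) for all x₂ ∈ [a,b], and f₂(x₁, a) < 0 < f₂(x₁, b) for all x₁ ∈ [a,b]. Then there exists a point (x₁, x₂) ∈ (a,b) × (a,b) such that f₁(x₁, x₂) = 0 and f₂(x₁, x₂) = 0. -/
theorem grid_lemma (N : ℕ) (S T : ℕ → ℕ → ℤ)
    (hc : ∀ i < N, ∀ j < N,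
      (S (i+1) j = S i j ∧ S i (j+1) = S i j ∧ S (i+1) (j+1) = S i j) ∨
      (T (i+1) j = T i j ∧ T i (j+1) = T i j ∧ T (i+1) (j+1) = T i j))
    (hS0 : ∀ j ≤ N, S 0 j = 0) (hS1 : ∀ j ≤ N, S N j = 1)
    (hT0 : ∀ i ≤ N, T i 0 = 0) (hT1 : ∀ i ≤ N, T i N = 1) : False := by
  have row : ∀ j < N, ∀ n ≤ N,
      ∑ i ∈ Finset.range n, (S (i+1) (j+1) - S i (j+1)) * T i (j+1)
        = ∑ i ∈ Finset.range n, (S (i+1) j - S i j) * T i j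
          + (S n (j+1) - S n j) * T n j - (S 0 (j+1) - S 0 j) * T 0 j := by
    intro j hj n
    induction n with
    | zero => intro _; simp
    | succ n ih =>
      intro hn
      rw [Finset.sum_range_succ, Finset.sum_range_succ, ih (by omega)]
      rcases hc n (by omega) j hj with ⟨e1, e2, e3⟩ | ⟨e1, e2, e3⟩
      · rw [e1, e2, e3]; ring
      · rw [e1, e2]; ring
  have all : ∀ j ≤ N, ∑ i ∈ Finset.range N, (S (i+1) j - S i j) * T i j = 0 := by
    intro j
    induction j with
    | zero =>
      intro _
      refine Finset.sum_eq_zero fun i hi => ?_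
      rw [hT0 i (Finset.mem_range.1 hi).le, mul_zero]
    | succ j ih =>
      intro hj
      rw [row j (by omega) N le_rfl, ih (by omega), hS1 _ hj, hS1 j (by omega), hS0 _ hj,
        hS0 j (by omega)]
      ring
  have h := all N le_rfl
  have h' : ∑ i ∈ Finset.range N, (S (i+1) N - S i N) * T i N
      = ∑ i ∈ Finset.range N, (S (i+1) N - S i N) := by
    refine Finset.sum_congr rfl fun i hi => ?_
    rw [hT1 i (Finset.mem_range.1 hi).le, mul_one]
  rw [h', Finset.sum_range_sub (fun i => S i N), hS1 N le_rfl, hS0 N le_rfl] at h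
  norm_num at h

/-- Poincaré–Miranda theorem in dimension two. -/
theorem poincare_miranda_dim2 (a b : ℝ) (hab : a < b) (f₁ f₂ : ℝ × ℝ → ℝ)
    (hf₁ : ContinuousOn f₁ (Set.Icc a b ×ˢ Set.Icc a b))
    (hf₂ : ContinuousOn f₂ (Set.Icc a b ×ˢ Set.Icc a b))
    (h1 : ∀ x₂ ∈ Set.Icc a b, f₁ (a, x₂) < 0 ∧ 0 < f₁ (b, x₂))
    (h2 : ∀ x₁ ∈ Set.Icc a b, f₂ (x₁, a) < 0 ∧ 0 < f₂ (x₁, b)) :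
    ∃ x ∈ Set.Ioo a b ×ˢ Set.Ioo a b, f₁ x = 0 ∧ f₂ x = 0 := by
  have hK : IsCompact (Set.Icc a b ×ˢ Set.Icc a b) := isCompact_Icc.prod isCompact_Icc
  suffices ∃ x ∈ Set.Icc a b ×ˢ Set.Icc a b, f₁ x = 0 ∧ f₂ x = 0 by
    obtain ⟨⟨x, y⟩, ⟨hx, hy⟩, e1, e2⟩ := this
    simp only at hx hy
    refine ⟨(x, y), ⟨⟨lt_of_le_of_ne hx.1 ?_, lt_of_le_of_ne hx.2 ?_⟩,
      ⟨lt_of_le_of_ne hy.1 ?_, lt_of_le_of_ne hy.2 ?_⟩⟩, e1, e2⟩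
    · rintro rfl; exact (h1 y hy).1.ne e1
    · rintro rfl; exact (h1 y hy).2.ne' e1
    · rintro rfl; exact (h2 x hx).1.ne e2
    · rintro rfl; exact (h2 x hx).2.ne' e2
  by_contra hno
  push Not at hno
  obtain ⟨z, hz, hmin⟩ := hK.exists_isMinOn ⟨(a, a), by simp [hab.le]⟩
    (hf₁.abs.sup hf₂.abs)
  obtain ⟨ε, hε, hεle⟩ : ∃ ε > 0, ∀ x ∈ Set.Icc a b ×ˢ Set.Icc a b, ε ≤ |f₁ x| ∨ ε ≤ |f₂ x| := by
    refine ⟨|f₁ z| ⊔ |f₂ z|, ?_, fun x hx => le_sup_iff.1 (hmin hx)⟩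
    by_cases h : f₁ z = 0
    · exact lt_sup_of_lt_right (abs_pos.2 (hno z hz h))
    · exact lt_sup_of_lt_left (abs_pos.2 h)
  obtain ⟨δ₁, hδ₁, u1⟩ := Metric.uniformContinuousOn_iff.1
    (hK.uniformContinuousOn_of_continuous hf₁) ε hε
  obtain ⟨δ₂, hδ₂, u2⟩ := Metric.uniformContinuousOn_iff.1
    (hK.uniformContinuousOn_of_continuous hf₂) ε hε
  obtain ⟨m, hm⟩ := exists_nat_gt ((b - a) / min δ₁ δ₂)
  have hδ : 0 < min δ₁ δ₂ := lt_min hδ₁ hδ₂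
  have hm0 : (0 : ℝ) < m := lt_trans (div_pos (sub_pos.2 hab) hδ) hm
  set d : ℝ := (b - a) / m with hd
  have hd0 : 0 < d := div_pos (sub_pos.2 hab) hm0
  have hdm : m * d = b - a := by rw [hd]; field_simp
  have hdδ : d < min δ₁ δ₂ := by
    rw [hd, div_lt_iff₀ hm0]; rw [div_lt_iff₀ hδ] at hm; linarith
  set P : ℕ → ℝ := fun i => a + i * d with hP
  have hP0 : P 0 = a := by simp [hP]
  have hPm : P m = b := by simp only [hP]; linarith
  have hPmem : ∀ i ≤ m, P i ∈ Set.Icc a b := by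
    intro i hi
    have : (i : ℝ) ≤ m := by exact_mod_cast hi
    have h3 : (i : ℝ) * d ≤ m * d := mul_le_mul_of_nonneg_right this hd0.le
    have h4 : 0 ≤ (i : ℝ) * d := by positivity
    constructor <;> simp only [hP] <;> linarith
  have hPs : ∀ i, dist (P (i+1)) (P i) = d := by
    intro i
    rw [Real.dist_eq]; simp only [hP]; push_cast
    rw [show a + (i + 1) * d - (a + i * d) = d by ring, abs_of_pos hd0]
  have sgn : ∀ u v : ℝ, ε ≤ |u| → dist v u < ε →
      (if 0 ≤ v then (1 : ℤ) else 0) = if 0 ≤ u then 1 else 0 := by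
    intro u v hu hv
    rw [Real.dist_eq, abs_lt] at hv
    by_cases h : 0 ≤ u
    · rw [abs_of_nonneg h] at hu
      rw [if_pos h, if_pos (by linarith)]
    · rw [abs_of_neg (not_le.1 h)] at hu
      rw [if_neg h, if_neg (by linarith)]
  have lt : ∀ i j i' j', dist (P i') (P i) ≤ d → dist (P j') (P j) ≤ d →
      dist (P i', P j') (P i, P j) < min δ₁ δ₂ := by
    intro i j i' j' h h'
    rw [Prod.dist_eq]
    exact (max_le h h').trans_lt hdδ
  have hself : ∀ i, dist (P i) (P i) ≤ d := by intro i; rw [dist_self]; exact hd0.le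
  refine grid_lemma m (fun i j => if 0 ≤ f₁ (P i, P j) then 1 else 0)
    (fun i j => if 0 ≤ f₂ (P i, P j) then 1 else 0) ?_ ?_ ?_ ?_ ?_
  · intro i hi j hj
    have mem : ∀ i ≤ m, ∀ j ≤ m, (P i, P j) ∈ Set.Icc a b ×ˢ Set.Icc a b :=
      fun i hi j hj => ⟨hPmem i hi, hPmem j hj⟩
    have l1 := lt i j (i+1) j (hPs i).le (hself j)
    have l2 := lt i j i (j+1) (hself i) (hPs j).le
    have l3 := lt i j (i+1) (j+1) (hPs i).le (hPs j).le
    have m0 := mem i hi.le j hj.le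
    have m1 := mem (i+1) hi j hj.le
    have m2 := mem i hi.le (j+1) hj
    have m3 := mem (i+1) hi (j+1) hj
    rcases hεle _ m0 with h | h
    · left
      exact ⟨sgn _ _ h (u1 _ m1 _ m0 (l1.trans_le (min_le_left _ _))),
        sgn _ _ h (u1 _ m2 _ m0 (l2.trans_le (min_le_left _ _))),
        sgn _ _ h (u1 _ m3 _ m0 (l3.trans_le (min_le_left _ _)))⟩
    · right
      exact ⟨sgn _ _ h (u2 _ m1 _ m0 (l1.trans_le (min_le_right _ _))),
        sgn _ _ h (u2 _ m2 _ m0 (l2.trans_le (min_le_right _ _))),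
        sgn _ _ h (u2 _ m3 _ m0 (l3.trans_le (min_le_right _ _)))⟩
  · intro j hj
    simp only [hP0]
    exact if_neg (not_le.2 (h1 _ (hPmem j hj)).1)
  · intro j hj
    simp only [hPm]
    exact if_pos (h1 _ (hPmem j hj)).2.le
  · intro j hj
    simp only [hP0]
    exact if_neg (not_le.2 (h2 _ (hPmem j hj)).1)
  · intro j hj
    simp only [hPm]
    exact if_pos (h2 _ (hPmem j hj)).2.le
end

section
/- Assume (H1), (H2), (H3) and (H4). Then the Nicholson-type system has at least one positive ω-periodic solution: there exist differentiable ω-periodic functions x₁, x₂ : ℝ → ℝ with x₁(t) > 0 and x₂(t) > 0 for all t ∈ ℝ, satisfying x₁'(t) = −δ₁₁(t)x₁(t)/(c₁₁(t)+x₁(t)) + b₁(t)f(x₁(t−τ₁(t))) + δ₁₂(t)x₂(t)/(c₁₂(t)+x₂(t)) and x₂'(t) = −δ₂₂(t)x₂(t)/(c₂₂(t)+x₂(t)) + b₂(t)f(x₂(t−τ₂(t))) + δ₂₁(t)x₁(t)/(c₂₁(t)+x₁(t)) for all t ∈ ℝ. -/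
open Real Set

/-- `x⁺ := max_{t ∈ [0,ω]} x t`. -/
noncomputable def supC (ω : ℝ) (x : ℝ → ℝ) : ℝ := sSup (x '' Icc 0 ω)

/-- `x⁻ := min_{t ∈ [0,ω]} x t`. -/
noncomputable def infC (ω : ℝ) (x : ℝ → ℝ) : ℝ := sInf (x '' Icc 0 ω)

/-- A continuous, ω-periodic, positive coefficient function. -/
def NiceCoef (ω : ℝ) (g : ℝ → ℝ) : Prop :=
  Continuous g ∧ Function.Periodic g ω ∧ ∀ t, 0 < g t


section Brouwer
open MeasureTheory

/-- Lagrange nodes: `det (1 + A)` is a fixed combination of `det (1 + t_i A)`. -/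
theorem det_interp {V : Type*} [NormedAddCommGroup V] [InnerProductSpace ℝ V]
    [FiniteDimensional ℝ V] (t0 : ℝ) (ht0 : 0 < t0) :
    ∃ (m : ℕ) (v : Fin m → ℝ) (w : Fin m → ℝ), (∀ i, 0 ≤ v i ∧ v i ≤ t0) ∧ ∑ i, w i = 1 ∧
      ∀ A : V →L[ℝ] V, (1 + A).det = ∑ i, w i * (1 + v i • A).det := by
  classical
  set b := Module.finBasis ℝ V
  set d := Module.finrank ℝ V
  let v : Fin (d + 1) → ℝ := fun i => t0 * ((i : ℝ) / (d + 1))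
  have hvinj : Function.Injective v := by
    intro i j hij
    have h1 : (0 : ℝ) < d + 1 := by positivity
    simp only [v] at hij
    have := mul_left_cancel₀ ht0.ne' hij
    rw [div_left_inj' h1.ne'] at this
    exact Fin.ext (by exact_mod_cast this)
  have hinj : Set.InjOn v (Finset.univ : Finset (Fin (d + 1))) := hvinj.injOn
  refine ⟨d + 1, v, fun i => (Lagrange.basis Finset.univ v i).eval 1, ?_, ?_, ?_⟩
  · intro i
    have h1 : (0 : ℝ) < d + 1 := by positivity
    have h2 : ((i : ℕ) : ℝ) ≤ d + 1 := by
      have := i.2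
      exact_mod_cast this.le
    constructor
    · simp only [v]; positivity
    · simp only [v]
      have : ((i : ℕ) : ℝ) / (d + 1) ≤ 1 := by
        rw [div_le_one h1]; exact h2
      nlinarith
  · have := Lagrange.sum_basis hinj (Finset.univ_nonempty)
    have h2 := congrArg (Polynomial.eval (1 : ℝ)) this
    rw [Polynomial.eval_finsetSum] at h2
    simpa using h2
  · intro A
    let M := LinearMap.toMatrix b b (A : V →ₗ[ℝ] V)
    let p : Polynomial ℝ := ((Polynomial.X : Polynomial ℝ) • M.map Polynomial.C
      + (1 : Matrix (Fin d) (Fin d) ℝ).map Polynomial.C).det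
    have hp : ∀ t : ℝ, p.eval t = (1 + t • A).det := by
      intro t
      have h1 : (1 + t • A).det = (LinearMap.toMatrix b b ((1 + t • A : V →L[ℝ] V) : V →ₗ[ℝ] V)).det := by
        rw [LinearMap.det_toMatrix]
      have h3 : ((1 + t • A : V →L[ℝ] V) : V →ₗ[ℝ] V) = LinearMap.id + t • (A : V →ₗ[ℝ] V) := by
        ext x; simp
      rw [h1, h3, map_add, map_smul, LinearMap.toMatrix_id]
      have h2 : p.eval t = (Polynomial.evalRingHom t) p := rfl
      rw [h2, RingHom.map_det]
      congr 1
      ext i j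
      by_cases hij : i = j <;>
      simp [M, hij] <;> ring
    have hdeg : p.degree < ((Finset.univ : Finset (Fin (d + 1))).card : ℕ) := by
      have h1 := Polynomial.natDegree_det_X_add_C_le M 1
      rw [Fintype.card_fin] at h1
      refine lt_of_le_of_lt Polynomial.degree_le_natDegree ?_
      rw [Finset.card_univ, Fintype.card_fin]
      have : p.natDegree < d + 1 := Nat.lt_succ_of_le h1
      exact_mod_cast this
    have h := Lagrange.eq_interpolate hinj hdeg
    have h2 := congrArg (Polynomial.eval (1 : ℝ)) h
    rw [hp, Lagrange.interpolate_apply, Polynomial.eval_finsetSum] at h2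
    rw [one_smul] at h2
    rw [h2]
    refine Finset.sum_congr rfl fun i _ => ?_
    rw [Polynomial.eval_mul, Polynomial.eval_C, hp]
    ring

theorem det_pos_of_small {V : Type*} [NormedAddCommGroup V] [InnerProductSpace ℝ V]
    [FiniteDimensional ℝ V] (A : V →L[ℝ] V) (hA : ‖A‖ < 1) : 0 < (1 + A).det := by
  have hne : ∀ s ∈ Icc (0 : ℝ) 1, (1 + s • A).det ≠ 0 := by
    intro s hs
    have h1 : ‖-(s • A)‖ < 1 := by
      rw [norm_neg, norm_smul, Real.norm_of_nonneg hs.1]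
      have := norm_nonneg A
      nlinarith [hs.2]
    have h2 := isUnit_one_sub_of_norm_lt_one h1
    rw [sub_neg_eq_add] at h2
    have h3 : IsUnit ((1 + s • A : V →L[ℝ] V) : V →ₗ[ℝ] V) :=
      h2.map (ContinuousLinearMap.toLinearMapRingHom : (V →L[ℝ] V) →+* (V →ₗ[ℝ] V))
    exact (LinearMap.isUnit_det _ h3).ne_zero
  have hc : ContinuousOn (fun s : ℝ => (1 + s • A).det) (Icc 0 1) := by
    apply Continuous.continuousOn
    exact ContinuousLinearMap.continuous_det.comp (by fun_prop)
  by_contra hcon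
  push Not at hcon
  have h0 : (1 + (0 : ℝ) • A).det = 1 := by
    rw [zero_smul, add_zero]; exact LinearMap.det_id
  have := intermediate_value_Icc' (zero_le_one) hc
  obtain ⟨s, hs, hs2⟩ := this (show (0 : ℝ) ∈ Icc _ _ from by
    simp only [h0, one_smul]; exact ⟨hcon, zero_le_one⟩)
  exact hne s hs hs2

section BrouwerVol
variable {V : Type*} [NormedAddCommGroup V] [InnerProductSpace ℝ V]
    [FiniteDimensional ℝ V] [MeasurableSpace V] [BorelSpace V]

theorem small_vol (g : V → V) (K : NNReal) (hg : LipschitzWith K g)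
    (h0 : ∀ x, 1 ≤ ‖x‖ → g x = 0) (hd : ∀ x, ‖x‖ < 1 → DifferentiableAt ℝ g x)
    (t : ℝ) (ht : 0 ≤ t) (htK : t * K < 1) :
    ∫ x in Metric.ball (0 : V) 1, (1 + t • fderiv ℝ g x).det = volume.real (Metric.ball (0 : V) 1) := by
  obtain ⟨T, rfl⟩ : ∃ T : NNReal, (T : ℝ) = t := ⟨⟨t, ht⟩, rfl⟩
  set f : V → V := fun x => x + (T : ℝ) • g x with hf
  set U := Metric.ball (0 : V) 1
  have hLip : LipschitzWith (T * K) (fun x => (T : ℝ) • g x) := by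
    refine LipschitzWith.of_dist_le_mul fun x y => ?_
    rw [dist_smul₀, Real.norm_of_nonneg ht, NNReal.coe_mul, mul_assoc]
    exact mul_le_mul_of_nonneg_left (hg.dist_le_mul x y) ht
  have hlt : (T * K : NNReal) < 1 := by
    rw [← NNReal.coe_lt_coe]; simpa using! htK
  have hinj : Function.Injective f := by
    intro x y hxy
    by_contra hne
    have hpos : 0 < dist x y := dist_pos.2 hne
    have h1 := hLip.dist_le_mul x y
    have h2 : dist ((T : ℝ) • g x) ((T : ℝ) • g y) = dist x y := by
      simp only [hf] at hxy
      rw [dist_eq_norm, dist_eq_norm, ← norm_neg]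
      congr 1
      have : (T : ℝ) • g x - (T : ℝ) • g y = -(x - y) := by
        have := sub_eq_zero.2 hxy
        rw [← sub_eq_zero]; rw [← this]; abel
      rw [this]; abel
    rw [h2] at h1
    have h3 : ((T * K : NNReal) : ℝ) < 1 := by exact_mod_cast hlt
    nlinarith
  have hsurj : Function.Surjective f := by
    intro y
    have hc : ContractingWith (T * K) (fun x => y - (T : ℝ) • g x) := by
      refine ⟨hlt, LipschitzWith.of_dist_le_mul fun x z => ?_⟩
      rw [dist_sub_left]
      exact hLip.dist_le_mul x z
    refine ⟨hc.fixedPoint, ?_⟩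
    have := hc.fixedPoint_isFixedPt
    simp only [hf]
    have h2 : y - (T : ℝ) • g hc.fixedPoint = hc.fixedPoint := this
    nth_rewrite 1 [← h2]
    abel
  have hout : ∀ x, x ∉ U → f x = x := by
    intro x hx
    simp only [U, Metric.mem_ball, dist_zero_right, not_lt] at hx
    simp [hf, h0 x hx]
  have himg : f '' U = U := by
    ext y
    constructor
    · rintro ⟨x, hx, rfl⟩
      by_contra hy
      have := hinj (hout _ hy)
      rw [this] at hy
      exact hy hx
    · intro hy
      obtain ⟨x, rfl⟩ := hsurj y
      by_contra hx
      have : x ∉ U := fun h => hx ⟨x, h, rfl⟩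
      rw [hout x this] at hy
      exact this hy
  have hder : ∀ x ∈ U, HasFDerivWithinAt f (1 + (T : ℝ) • fderiv ℝ g x) U x := by
    intro x hx
    have := (hd x (by simpa [U] using hx)).hasFDerivAt
    exact ((hasFDerivAt_id x).add (this.const_smul (T : ℝ))).hasFDerivWithinAt
  have hmain := integral_image_eq_integral_abs_det_fderiv_smul volume
    (Metric.isOpen_ball.measurableSet) hder hinj.injOn (fun _ => (1 : ℝ))
  rw [himg] at hmain
  simp only [smul_eq_mul, mul_one, integral_const, measureReal_restrict_apply_univ] at hmain
  rw [hmain]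
  refine setIntegral_congr_fun Metric.isOpen_ball.measurableSet fun x _ => ?_
  have : 0 < (1 + (T : ℝ) • fderiv ℝ g x).det := by
    apply det_pos_of_small
    rw [norm_smul, Real.norm_of_nonneg ht]
    have := norm_fderiv_le_of_lipschitz ℝ (x₀ := x) hg
    nlinarith
  simp only [abs_of_pos this]

theorem full_vol (g : V → V) (K : NNReal) (hg : LipschitzWith K g)
    (h0 : ∀ x, 1 ≤ ‖x‖ → g x = 0) (hd : ∀ x, ‖x‖ < 1 → DifferentiableAt ℝ g x) :
    ∫ x in Metric.ball (0 : V) 1, (1 + fderiv ℝ g x).det = volume.real (Metric.ball (0 : V) 1) := by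
  obtain ⟨m, v, w, hv, hw, hdet⟩ := det_interp (V := V) (1 / (K + 1)) (by positivity)
  have hint : ∀ t : ℝ, IntegrableOn (fun x => (1 + t • fderiv ℝ g x).det) (Metric.ball (0 : V) 1) := by
    intro t
    have hcont : Continuous (fun A : V →L[ℝ] V => (1 + t • A).det) :=
      ContinuousLinearMap.continuous_det.comp (by fun_prop)
    obtain ⟨C, hC⟩ := (isCompact_closedBall (0 : V →L[ℝ] V) K).exists_bound_of_continuousOn
      hcont.continuousOn
    refine Measure.integrableOn_of_bounded (M := C) measure_ball_lt_top.ne ?_ ?_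
    · exact (hcont.measurable.comp (measurable_fderiv ℝ g)).aestronglyMeasurable
    · refine Filter.Eventually.of_forall fun x => hC _ ?_
      simpa using norm_fderiv_le_of_lipschitz ℝ (x₀ := x) hg
  have hdet' : ∀ x, (1 + fderiv ℝ g x).det = ∑ i, w i * (1 + v i • fderiv ℝ g x).det :=
    fun x => hdet _
  rw [integral_congr_ae (Filter.Eventually.of_forall hdet')]
  rw [integral_finsetSum _ (fun i _ => (hint (v i)).const_mul (w i))]
  simp_rw [integral_const_mul]
  have : ∀ i, ∫ x in Metric.ball (0 : V) 1, (1 + v i • fderiv ℝ g x).det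
      = volume.real (Metric.ball (0 : V) 1) := by
    intro i
    refine small_vol g K hg h0 hd (v i) (hv i).1 ?_
    have h1 := (hv i).2
    have hK : (0 : ℝ) ≤ K := K.2
    have h2 : (1 / ((K : ℝ) + 1)) * K < 1 := by
      rw [one_div, inv_mul_lt_iff₀ (by positivity)]; linarith
    nlinarith
  simp_rw [this]
  rw [← Finset.sum_mul, hw, one_mul]

theorem no_retract (g : V → V) (K : NNReal) (hg : LipschitzWith K g)
    (h0 : ∀ x, 1 ≤ ‖x‖ → g x = 0) (hd : ∀ x, ‖x‖ < 1 → DifferentiableAt ℝ g x)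
    (h1 : ∀ x, ‖x‖ < 1 → ‖x + g x‖ = 1) : False := by
  have h := full_vol g K hg h0 hd
  have hz : ∀ x ∈ Metric.ball (0 : V) 1, (1 + fderiv ℝ g x).det = 0 := by
    intro x hx
    have hx' : ‖x‖ < 1 := by simpa using hx
    have hdr : HasFDerivAt (fun x => x + g x) (1 + fderiv ℝ g x) x :=
      (hasFDerivAt_id x).add (hd x hx').hasFDerivAt
    have hns := hdr.norm_sq
    have hconst : (fun x => ‖x + g x‖ ^ 2) =ᶠ[nhds x] fun _ => (1 : ℝ) := by
      filter_upwards [Metric.isOpen_ball.mem_nhds hx] with y hy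
      rw [h1 y (by simpa using hy), one_pow]
    have heq := hns.unique ((hasFDerivAt_const (1 : ℝ) x).congr_of_eventuallyEq hconst)
    by_contra hne
    have hu : IsUnit (LinearMap.det ((1 + fderiv ℝ g x : V →L[ℝ] V) : V →ₗ[ℝ] V)) := by
      exact isUnit_iff_ne_zero.2 hne
    have hu2 := (LinearMap.isUnit_iff_isUnit_det _).2 hu
    have hbij := (Module.End.isUnit_iff _).1 hu2
    obtain ⟨y, hy⟩ := hbij.2 (x + g x)
    have := congrArg (fun L : V →L[ℝ] ℝ => L y) heq
    have hy' : (1 + fderiv ℝ g x) y = x + g x := hy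
    simp only [_root_.smul_apply, ContinuousLinearMap.comp_apply, hy',
      innerSL_apply_apply, _root_.zero_apply, real_inner_self_eq_norm_sq, h1 x hx'] at this
    norm_num at this
  rw [setIntegral_congr_fun Metric.isOpen_ball.measurableSet hz] at h
  simp only [integral_zero] at h
  have hpos : 0 < volume.real (Metric.ball (0 : V) 1) :=
    ENNReal.toReal_pos (Metric.measure_ball_pos _ _ one_pos).ne' measure_ball_lt_top.ne
  linarith

end BrouwerVol

theorem smooth_fix {V : Type*} [NormedAddCommGroup V] [InnerProductSpace ℝ V]
    [FiniteDimensional ℝ V] (h : V → V) (hh : ContDiff ℝ 1 h) (hb : ∀ x, ‖h x‖ < 1) :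
    ∃ x, ‖x‖ ≤ 1 ∧ h x = x := by
  let _ : MeasurableSpace V := borel V
  have _ : BorelSpace V := ⟨rfl⟩
  by_contra hcon
  push Not at hcon
  set v : V → V := fun x => x - h x with hv
  set p : V → ℝ := fun x => inner ℝ x (v x) with hp
  set q : V → ℝ := fun x => ‖v x‖ ^ 2 with hq
  set D : V → ℝ := fun x => p x ^ 2 + q x * (1 - ‖x‖ ^ 2) with hD
  set s : V → ℝ := fun x => (√(D x) - p x) / q x with hs
  set G : V → V := fun x => s x • v x with hG
  have hqpos : ∀ x, ‖x‖ ≤ 1 → 0 < q x := by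
    intro x hx
    have : v x ≠ 0 := by
      intro h0
      exact hcon x hx (sub_eq_zero.1 h0).symm
    have := norm_pos_iff.2 this
    simp only [hq]; positivity
  have hppos : ∀ x, ‖x‖ = 1 → 0 < p x := by
    intro x hx
    simp only [hp, hv, inner_sub_right, real_inner_self_eq_norm_sq, hx]
    have := real_inner_le_norm x (h x)
    rw [hx] at this
    have := hb x
    linarith
  have hDpos : ∀ x, ‖x‖ ≤ 1 → 0 < D x := by
    intro x hx
    rcases hx.lt_or_eq with h1 | h1
    · have : 0 < 1 - ‖x‖ ^ 2 := by nlinarith [norm_nonneg x]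
      have := mul_pos (hqpos x hx) this
      simp only [hD]; positivity
    · have := hppos x h1
      simp only [hD, h1]
      norm_num
      positivity
  have hvC : ContDiff ℝ 1 v := contDiff_id.sub hh
  have hpC : ContDiff ℝ 1 p := contDiff_id.inner ℝ hvC
  have hqC : ContDiff ℝ 1 q := hvC.norm_sq ℝ
  have hDC : ContDiff ℝ 1 D := (hpC.pow 2).add (hqC.mul (contDiff_const.sub (contDiff_id.norm_sq ℝ)))
  have hGC : ∀ x, ‖x‖ ≤ 1 → ContDiffAt ℝ 1 G x := by
    intro x hx
    exact (((hDC.contDiffAt.sqrt (hDpos x hx).ne').sub hpC.contDiffAt).div hqC.contDiffAt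
      (hqpos x hx).ne').smul hvC.contDiffAt
  have hG1 : ∀ x, ‖x‖ = 1 → G x = 0 := by
    intro x hx
    have : D x = p x ^ 2 := by simp [hD, hx]
    simp [hG, hs, this, Real.sqrt_sq (hppos x hx).le]
  have hGn : ∀ x, ‖x‖ ≤ 1 → ‖x + G x‖ = 1 := by
    intro x hx
    have h1 : ‖x + G x‖ ^ 2 = ‖x‖ ^ 2 + 2 * (s x * p x) + s x ^ 2 * q x := by
      rw [norm_add_sq_real]
      simp only [hG, real_inner_smul_right, norm_smul, mul_pow, Real.norm_eq_abs, sq_abs]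
      rfl
    have hqx := hqpos x hx
    have h2 : s x * q x = √(D x) - p x := by
      simp only [hs]; field_simp
    have h3 : √(D x) ^ 2 = p x ^ 2 + q x * (1 - ‖x‖ ^ 2) := Real.sq_sqrt (hDpos x hx).le
    have h4 : q x * ‖x + G x‖ ^ 2 = q x * 1 := by
      rw [h1]
      have : q x * (‖x‖ ^ 2 + 2 * (s x * p x) + s x ^ 2 * q x)
        = q x * ‖x‖ ^ 2 + 2 * p x * (s x * q x) + (s x * q x) ^ 2 := by ring
      rw [this, h2]
      nlinarith
    have h5 := mul_left_cancel₀ hqx.ne' h4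
    have := norm_nonneg (x + G x)
    nlinarith
  obtain ⟨K, hK⟩ := (show ContDiffOn ℝ 1 G (Metric.closedBall 0 1) from fun x hx =>
    (hGC x (by simpa using hx)).contDiffWithinAt).exists_lipschitzOnWith one_ne_zero
      (convex_closedBall 0 1) (isCompact_closedBall 0 1)
  classical
  let g : V → V := fun x => if ‖x‖ < 1 then G x else 0
  have key : ∀ x y, ‖x‖ < 1 → 1 ≤ ‖y‖ → ‖G x‖ ≤ (2 * K : NNReal) * ‖x - y‖ := by
    intro x y hx hy
    have hy0 : ‖y‖ ≠ 0 := by linarith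
    set z := (‖y‖)⁻¹ • y with hz
    have hz1 : ‖z‖ = 1 := by
      rw [hz, norm_smul, norm_inv, norm_norm, inv_mul_cancel₀ hy0]
    have h1 := hK.dist_le_mul x (by simpa using hx.le) z (by simp [hz1])
    rw [hG1 z hz1, dist_zero_right, dist_eq_norm] at h1
    have h2 : ‖y - z‖ = ‖y‖ - 1 := by
      have : y - z = (1 - (‖y‖)⁻¹) • y := by rw [sub_smul, one_smul]
      rw [this, norm_smul, Real.norm_of_nonneg]
      · field_simp
      · have := inv_le_one_of_one_le₀ hy
        linarith
    have h3 : ‖x - z‖ ≤ ‖x - y‖ + ‖y - z‖ := norm_sub_le_norm_sub_add_norm_sub x y z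
    have h4 : ‖y‖ - ‖x‖ ≤ ‖x - y‖ := by
      rw [norm_sub_rev]; exact norm_sub_norm_le y x
    have h5 : ‖x - z‖ ≤ 2 * ‖x - y‖ := by linarith
    calc ‖G x‖ ≤ K * ‖x - z‖ := h1
      _ ≤ K * (2 * ‖x - y‖) := mul_le_mul_of_nonneg_left h5 K.2
      _ = _ := by push_cast; ring
  have hgL : LipschitzWith (2 * K) g := by
    refine LipschitzWith.of_dist_le_mul fun x y => ?_
    rw [dist_eq_norm, dist_eq_norm]
    by_cases hx : ‖x‖ < 1 <;> by_cases hy : ‖y‖ < 1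
    · simp only [g, hx, hy, if_true]
      have h1 := hK.dist_le_mul x (by simpa using hx.le) y (by simpa using hy.le)
      rw [dist_eq_norm, dist_eq_norm] at h1
      refine h1.trans ?_
      push_cast
      have : 0 ≤ (K : ℝ) * ‖x - y‖ := by positivity
      linarith
    · simp only [g, hx, hy, if_true, if_false, sub_zero]
      exact key x y hx (not_lt.1 hy)
    · simp only [g, hx, hy, if_true, if_false, zero_sub, norm_neg]
      rw [norm_sub_rev]
      exact key y x hy (not_lt.1 hx)
    · simp only [g, hx, hy, if_false, sub_zero, norm_zero]
      positivity
  refine no_retract g (2 * K) hgL (fun x hx => by simp [g, not_lt.2 hx]) ?_ ?_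
  · intro x hx
    have : g =ᶠ[nhds x] G := by
      filter_upwards [Metric.isOpen_ball.mem_nhds (show x ∈ Metric.ball (0 : V) 1 by simpa using hx)]
        with y hy
      have : ‖y‖ < 1 := by simpa using hy
      simp [g, this]
    exact ((hGC x hx.le).differentiableAt one_ne_zero).congr_of_eventuallyEq this
  · intro x hx
    simp only [g, hx, if_true]
    exact hGn x hx.le

/-- Brouwer: a bounded continuous self-map of a Euclidean space has a fixed point. -/
theorem brouwer_bdd {V : Type*} [NormedAddCommGroup V] [InnerProductSpace ℝ V]
    [FiniteDimensional ℝ V] (F : V → V) (hF : Continuous F) (C : ℝ) (hC : ∀ x, ‖F x‖ ≤ C) :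
    ∃ x, F x = x := by
  have hC0 : 0 ≤ C := (norm_nonneg _).trans (hC 0)
  set R := 2 * (C + 1) with hR
  have hRpos : 0 < R := by positivity
  -- rescaled map
  set H : V → V := fun x => R⁻¹ • F (R • x) with hH
  have hHc : Continuous H := by fun_prop
  have hHb : ∀ x, ‖H x‖ < 1 / 2 := by
    intro x
    rw [hH]
    simp only [norm_smul, norm_inv, Real.norm_of_nonneg hRpos.le]
    rw [inv_mul_lt_iff₀ hRpos]
    have := hC (R • x)
    rw [hR]; linarith
  suffices ∃ x, H x = x by
    obtain ⟨x, hx⟩ := this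
    refine ⟨R • x, ?_⟩
    have h2 : R⁻¹ • F (R • x) = x := hx
    have h3 := congrArg (fun z => R • z) h2
    simpa only [smul_inv_smul₀ hRpos.ne'] using h3
  by_contra hcon
  push Not at hcon
  obtain ⟨x0, hx0, hmin⟩ := (isCompact_closedBall (0 : V) 1).exists_isMinOn
    ⟨0, by simp⟩ (show ContinuousOn (fun x => ‖H x - x‖) _ by fun_prop)
  have hm : 0 < ‖H x0 - x0‖ := norm_pos_iff.2 (sub_ne_zero.2 (hcon x0))
  obtain ⟨h, hh, happ, -⟩ := hHc.exists_contDiff_approx 1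
    (ε := fun _ => min (1 / 2) ‖H x0 - x0‖) continuous_const (fun _ => lt_min (by norm_num) hm)
  obtain ⟨x, hx, hfx⟩ := smooth_fix h hh (fun x => by
    have h1 := (happ x).trans_le (min_le_left _ _)
    rw [dist_eq_norm] at h1
    have h2 := hHb x
    have h3 : ‖h x‖ ≤ ‖h x - H x‖ + ‖H x‖ := norm_le_norm_sub_add _ _
    linarith)
  have h1 := (happ x).trans_le (min_le_right _ _)
  rw [hfx, dist_eq_norm, norm_sub_rev] at h1
  have h2 : ‖H x0 - x0‖ ≤ ‖H x - x‖ := hmin (by simpa using hx)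
  linarith

end Brouwer

/-- Schauder: a continuous self-map of a normed space with relatively compact range
has a fixed point. -/
theorem schauder_fix {X : Type*} [NormedAddCommGroup X] [NormedSpace ℝ X] (T : X → X)
    (hT : Continuous T) (S : Set X) (hS : IsCompact S) (hTS : ∀ x, T x ∈ S) : ∃ x, T x = x := by
  have approx : ∀ ε : ℝ, 0 < ε → ∃ x, ‖x - T x‖ ≤ ε := by
    intro ε hε
    obtain ⟨t, -, htfin, hcov⟩ := hS.finite_cover_balls hε
    set ι := htfin.toFinset with hι
    let φ : ι → X → ℝ := fun i x => max 0 (ε - ‖x - (i : X)‖)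
    have hφc : ∀ i, Continuous (φ i) := fun i => by fun_prop
    have hφ0 : ∀ i x, 0 ≤ φ i x := fun i x => le_max_left _ _
    let σ : X → ℝ := fun x => ∑ i, φ i x
    have hσc : Continuous σ := continuous_finsetSum _ fun i _ => hφc i
    have hσ : ∀ x, 0 < σ (T x) := by
      intro x
      have := hcov (hTS x)
      simp only [mem_iUnion, exists_prop] at this
      obtain ⟨y, hy, hxy⟩ := this
      refine Finset.sum_pos' (fun i _ => hφ0 i _) ⟨⟨y, htfin.mem_toFinset.2 hy⟩, Finset.mem_univ _, ?_⟩
      simp only [φ]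
      rw [Metric.mem_ball, dist_eq_norm] at hxy
      exact lt_max_of_lt_right (by linarith)
    let ψ : ι → X → ℝ := fun i x => φ i (T x) / σ (T x)
    have hψc : ∀ i, Continuous (ψ i) := fun i =>
      ((hφc i).comp hT).div (hσc.comp hT) fun x => (hσ x).ne'
    have hψ0 : ∀ i x, 0 ≤ ψ i x := fun i x => div_nonneg (hφ0 _ _) (hσ x).le
    have hψ1 : ∀ x, ∑ i, ψ i x = 1 := by
      intro x
      simp only [ψ]
      rw [← Finset.sum_div]
      exact div_self (hσ x).ne'
    let comb : EuclideanSpace ℝ ι → X := fun a => ∑ i, a i • (i : X)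
    have hcomb : Continuous comb := by fun_prop
    let F : EuclideanSpace ℝ ι → EuclideanSpace ℝ ι :=
      fun a => WithLp.toLp 2 (fun i => ψ i (comb a))
    have hF : Continuous F := by
      refine (PiLp.continuous_toLp 2 _).comp (continuous_pi fun i => (hψc i).comp hcomb)
    obtain ⟨a, ha⟩ := brouwer_bdd F hF 1 (fun a => by
      rw [EuclideanSpace.norm_eq]
      rw [Real.sqrt_le_iff]
      refine ⟨zero_le_one, ?_⟩
      rw [one_pow]
      rw [← hψ1 (comb a)]
      refine Finset.sum_le_sum fun i _ => ?_
      have h1 : ψ i (comb a) ≤ 1 := by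
        rw [← hψ1 (comb a)]
        exact Finset.single_le_sum (fun j _ => hψ0 j (comb a)) (Finset.mem_univ i)
      have h0 := hψ0 i (comb a)
      simp only [F, Real.norm_eq_abs, sq_abs]
      nlinarith)
    refine ⟨comb a, ?_⟩
    have ha' : ∀ i, a i = ψ i (comb a) := fun i => by
      conv_lhs => rw [← ha]
    set x := comb a with hx
    have h1 : x - T x = ∑ i, ψ i x • ((i : X) - T x) := by
      simp only [smul_sub, Finset.sum_sub_distrib]
      rw [← Finset.sum_smul, hψ1, one_smul]
      congr 1
      conv_lhs => rw [hx]
      exact Finset.sum_congr rfl fun i _ => by rw [ha' i]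
    rw [h1]
    calc ‖∑ i, ψ i x • ((i : X) - T x)‖ ≤ ∑ i, ‖ψ i x • ((i : X) - T x)‖ := norm_sum_le _ _
      _ ≤ ∑ i, ψ i x * ε := by
        refine Finset.sum_le_sum fun i _ => ?_
        rw [norm_smul, Real.norm_of_nonneg (hψ0 i x)]
        by_cases h : ‖T x - (i : X)‖ ≤ ε
        · rw [norm_sub_rev]
          exact mul_le_mul_of_nonneg_left h (hψ0 i x)
        · have : ψ i x = 0 := by
            simp only [ψ, φ]
            rw [max_eq_left (by linarith), zero_div]
          simp [this]
      _ = ε := by rw [← Finset.sum_mul, hψ1, one_mul]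
  choose! x hx using approx
  let u : ℕ → X := fun n => x (1 / ((n : ℝ) + 1))
  have hu : ∀ n, ‖u n - T (u n)‖ ≤ 1 / ((n : ℝ) + 1) := fun n => hx _ (by positivity)
  obtain ⟨z, -, k, hk, hlim⟩ := hS.tendsto_subseq (fun n => hTS (u n))
  have hd : Filter.Tendsto (fun n => u n - T (u n)) Filter.atTop (nhds 0) :=
    squeeze_zero_norm hu tendsto_one_div_add_atTop_nhds_zero_nat
  have hd2 := hd.comp hk.tendsto_atTop
  have hul : Filter.Tendsto (u ∘ k) Filter.atTop (nhds z) := by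
    have := hd2.add hlim
    simpa [Function.comp_def] using! this
  have h3 : Filter.Tendsto (fun n => T ((u ∘ k) n)) Filter.atTop (nhds (T z)) :=
    (hT.tendsto z).comp hul
  exact ⟨z, tendsto_nhds_unique h3 hlim⟩

section Green

/-- Periodic solution operator of `y' + K y = G`. -/
noncomputable def greenOp (ω K : ℝ) (G : AddCircle ω → ℝ) (s : AddCircle ω) : ℝ :=
  (Real.exp (K * ω) - 1)⁻¹ * ∫ u in (0 : ℝ)..ω, Real.exp (K * u) * G (s + (u : AddCircle ω))

theorem integral_exp_mul {K ω : ℝ} (hK : 0 < K) :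
    ∫ u in (0 : ℝ)..ω, Real.exp (K * u) = (Real.exp (K * ω) - 1) / K := by
  have : ∀ x ∈ Set.uIcc 0 ω, HasDerivAt (fun u => Real.exp (K * u) / K) (Real.exp (K * x)) x := by
    intro x _
    have h1 : HasDerivAt (fun u : ℝ => K * u) K x := by
      simpa using (hasDerivAt_id x).const_mul K
    refine (h1.exp.div_const K).congr_deriv ?_
    rw [mul_div_assoc, div_self hK.ne', mul_one]
  rw [intervalIntegral.integral_eq_sub_of_hasDerivAt this
    (Continuous.intervalIntegrable (by fun_prop) _ _)]
  simp
  ring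

theorem greenOp_bounds {ω K m M : ℝ} (hω : 0 < ω) (hK : 0 < K) (G : AddCircle ω → ℝ)
    (hG : Continuous G) (hb : ∀ s, K * m ≤ G s ∧ G s ≤ K * M) (s : AddCircle ω) :
    m ≤ greenOp ω K G s ∧ greenOp ω K G s ≤ M := by
  have hE : 0 < Real.exp (K * ω) - 1 := by
    have := Real.add_one_lt_exp (x := K * ω) (by positivity)
    have := mul_pos hK hω
    linarith
  have hc : Continuous (fun u : ℝ => Real.exp (K * u) * G (s + (u : AddCircle ω))) := by
    have : Continuous (fun u : ℝ => (u : AddCircle ω)) := AddCircle.continuous_mk' ω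
    fun_prop
  have hcst : ∀ c : ℝ, ∫ u in (0 : ℝ)..ω, Real.exp (K * u) * (K * c) = (Real.exp (K * ω) - 1) * c := by
    intro c
    rw [intervalIntegral.integral_mul_const, integral_exp_mul hK]
    field_simp
  have hi : ∀ c : ℝ, IntervalIntegrable (fun u => Real.exp (K * u) * (K * c)) MeasureTheory.volume 0 ω :=
    fun c => Continuous.intervalIntegrable (by fun_prop) _ _
  unfold greenOp
  constructor
  · rw [le_inv_mul_iff₀ hE, ← hcst]
    exact intervalIntegral.integral_mono_on hω.le (hi m) (hc.intervalIntegrable _ _)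
      fun u _ => mul_le_mul_of_nonneg_left (hb _).1 (Real.exp_pos _).le
  · rw [inv_mul_le_iff₀ hE, ← hcst]
    exact intervalIntegral.integral_mono_on hω.le (hc.intervalIntegrable _ _) (hi M)
      fun u _ => mul_le_mul_of_nonneg_left (hb _).2 (Real.exp_pos _).le

theorem greenOp_deriv {ω K : ℝ} (hω : 0 < ω) (hK : 0 < K) (G : AddCircle ω → ℝ)
    (hG : Continuous G) (t : ℝ) :
    HasDerivAt (fun t : ℝ => greenOp ω K G (t : AddCircle ω))
      (G (t : AddCircle ω) - K * greenOp ω K G (t : AddCircle ω)) t := by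
  have hE : 0 < Real.exp (K * ω) - 1 := by
    have := Real.add_one_lt_exp (x := K * ω) (by positivity)
    have := mul_pos hK hω
    linarith
  have hcoe : Continuous (fun u : ℝ => (u : AddCircle ω)) := AddCircle.continuous_mk' ω
  set q : ℝ → ℝ := fun s => Real.exp (K * s) * G (s : AddCircle ω) with hq
  have hqc : Continuous q := by fun_prop
  set H : ℝ → ℝ := fun t => ∫ s in (0 : ℝ)..t, q s with hH
  have hHd : ∀ t, HasDerivAt H (q t) t := fun t =>
    intervalIntegral.integral_hasDerivAt_right (hqc.intervalIntegrable _ _)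
      (hqc.stronglyMeasurableAtFilter _ _) hqc.continuousAt
  have hform : ∀ t : ℝ, greenOp ω K G (t : AddCircle ω)
      = (Real.exp (K * ω) - 1)⁻¹ * (Real.exp (-(K * t)) * (H (t + ω) - H t)) := by
    intro t
    unfold greenOp
    congr 1
    have h1 : H (t + ω) - H t = ∫ s in t..(t + ω), q s := by
      simp only [hH]
      rw [intervalIntegral.integral_interval_sub_left (hqc.intervalIntegrable _ _)
        (hqc.intervalIntegrable _ _)]
    have h2 : ∫ s in t..(t + ω), q s = ∫ u in (0 : ℝ)..ω, q (t + u) := by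
      rw [intervalIntegral.integral_comp_add_left (fun s => q s) t, add_zero]
    rw [h1, h2, ← intervalIntegral.integral_const_mul]
    refine intervalIntegral.integral_congr fun u _ => ?_
    simp only [hq]
    rw [← mul_assoc, ← Real.exp_add, AddCircle.coe_add]
    congr 2
    ring
  have hfun : (fun t : ℝ => greenOp ω K G (t : AddCircle ω))
      = fun t => (Real.exp (K * ω) - 1)⁻¹ * (Real.exp (-(K * t)) * (H (t + ω) - H t)) :=
    funext hform
  rw [hfun, hform t]
  have he : HasDerivAt (fun t : ℝ => Real.exp (-(K * t))) (Real.exp (-(K * t)) * (-K)) t := by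
    have h1 : HasDerivAt (fun t : ℝ => -(K * t)) (-K) t := by
      have h2 : HasDerivAt (fun t : ℝ => K * t) K t := by
        simpa using (hasDerivAt_id t).const_mul K
      exact h2.neg
    exact h1.exp
  have hs : HasDerivAt (fun t => H (t + ω)) (q (t + ω)) t := (hHd (t + ω)).comp_add_const t ω
  have hall := (he.mul (hs.sub (hHd t))).const_mul ((Real.exp (K * ω) - 1)⁻¹)
  refine hall.congr_deriv ?_
  have hper : q (t + ω) = Real.exp (K * ω) * q t := by
    simp only [hq]
    rw [AddCircle.coe_add_period, mul_add, Real.exp_add]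
    ring
  have hq2 : G (t : AddCircle ω) = Real.exp (-(K * t)) * q t := by
    simp only [hq]
    rw [← mul_assoc, ← Real.exp_add]
    simp
  simp only [Pi.sub_apply]
  rw [hper, hq2]
  field_simp
  ring

theorem compact_lip {ω : ℝ} [Fact (0 < ω)] (m M L : ℝ) :
    IsCompact {x : C(AddCircle ω, ℝ) | (∀ s, x s ∈ Icc m M) ∧
      ∀ t t' : ℝ, |x (t : AddCircle ω) - x (t' : AddCircle ω)| ≤ L * |t - t'|} := by
  have hqm : Topology.IsQuotientMap (fun u : ℝ => (u : AddCircle ω)) := isQuotientMap_quotient_mk'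
  have hopen : IsOpenMap (fun u : ℝ => (u : AddCircle ω)) := QuotientAddGroup.isOpenMap_coe
  apply ArzelaAscoli.isCompact_of_equicontinuous
  · have heq : (ContinuousMap.toFun '' {x : C(AddCircle ω, ℝ) | (∀ s, x s ∈ Icc m M) ∧
      ∀ t t' : ℝ, |x (t : AddCircle ω) - x (t' : AddCircle ω)| ≤ L * |t - t'|})
      = (Set.pi univ fun _ => Icc m M) ∩ {f : AddCircle ω → ℝ |
        ∀ t t' : ℝ, |f (t : AddCircle ω) - f (t' : AddCircle ω)| ≤ L * |t - t'|} := by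
      ext f
      constructor
      · rintro ⟨x, hx, rfl⟩
        exact ⟨fun s _ => hx.1 s, hx.2⟩
      · rintro ⟨h1, h2⟩
        have hc : Continuous f := by
          rw [hqm.continuous_iff]
          refine (LipschitzWith.of_dist_le_mul (K := Real.toNNReal L) fun t t' => ?_).continuous
          rw [Real.dist_eq, Real.dist_eq]
          refine (h2 t t').trans ?_
          exact mul_le_mul_of_nonneg_right (Real.le_coe_toNNReal L) (abs_nonneg _)
        exact ⟨⟨f, hc⟩, ⟨fun s => h1 s (mem_univ s), h2⟩, rfl⟩
    rw [heq]
    refine (isCompact_univ_pi fun _ => isCompact_Icc).inter_right ?_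
    simp only [ofPred_forall]
    refine isClosed_iInter fun t => isClosed_iInter fun t' => ?_
    exact isClosed_le (by fun_prop) continuous_const
  · intro s0
    obtain ⟨t0, rfl⟩ := hqm.surjective s0
    rw [Metric.equicontinuousAt_iff_right]
    intro ε hε
    rw [← hopen.map_nhds_eq hqm.continuous.continuousAt, Filter.eventually_map]
    have : ∀ᶠ t in nhds t0, L * |t0 - t| < ε := by
      have hc : Continuous fun t => L * |t0 - t| := by fun_prop
      have := hc.tendsto t0
      simp only [sub_self, abs_zero, mul_zero] at this
      exact this.eventually (gt_mem_nhds hε)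
    filter_upwards [this] with t ht i
    rw [Real.dist_eq]
    exact (i.2.2 t0 t).trans_lt ht

theorem abs_periodic {ω K m M : ℝ} [hF : Fact (0 < ω)] (hK : 0 < K)
    (θ₁ θ₂ : AddCircle ω → AddCircle ω) (hθ₁ : Continuous θ₁) (hθ₂ : Continuous θ₂)
    (N₁ N₂ : AddCircle ω × ℝ × ℝ × ℝ → ℝ) (hN₁ : Continuous N₁) (hN₂ : Continuous N₂)
    (hb₁ : ∀ p, K * m ≤ N₁ p ∧ N₁ p ≤ K * M) (hb₂ : ∀ p, K * m ≤ N₂ p ∧ N₂ p ≤ K * M) :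
    ∃ x y : C(AddCircle ω, ℝ), (∀ s, m ≤ x s ∧ x s ≤ M) ∧ (∀ s, m ≤ y s ∧ y s ≤ M) ∧
      (∀ t : ℝ, HasDerivAt (fun t : ℝ => x t) (N₁ (t, x t, x (θ₁ t), y t) - K * x t) t) ∧
      (∀ t : ℝ, HasDerivAt (fun t : ℝ => y t) (N₂ (t, y t, y (θ₂ t), x t) - K * y t) t) := by
  have hω : 0 < ω := hF.out
  have hcoe : Continuous (fun u : ℝ => (u : AddCircle ω)) := AddCircle.continuous_mk' ω
  -- one scalar component
  have comp : ∀ (θ : AddCircle ω → AddCircle ω) (_ : Continuous θ)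
      (N : AddCircle ω × ℝ × ℝ × ℝ → ℝ) (_ : Continuous N)
      (_ : ∀ p, K * m ≤ N p ∧ N p ≤ K * M),
      ∃ T : C(AddCircle ω, ℝ) × C(AddCircle ω, ℝ) → C(AddCircle ω, ℝ), Continuous T ∧
        (∀ z s, m ≤ T z s ∧ T z s ≤ M) ∧
        ∀ z, ∀ t : ℝ, HasDerivAt (fun t : ℝ => T z t)
          (N (t, z.1 t, z.1 (θ t), z.2 t) - K * T z t) t := by
    intro θ hθ N hN hb
    let G : C(AddCircle ω, ℝ) × C(AddCircle ω, ℝ) → AddCircle ω → ℝ :=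
      fun z s => N (s, z.1 s, z.1 (θ s), z.2 s)
    have hG : Continuous (Function.uncurry G) := by
      simp only [G, Function.uncurry_def]
      fun_prop
    have hGz : ∀ z, Continuous (G z) := fun z => hG.comp (by fun_prop : Continuous fun s => (z, s))
    have hJ : Continuous (Function.uncurry fun z s => greenOp ω K (G z) s) := by
      simp only [Function.uncurry_def, greenOp]
      refine continuous_const.mul ?_
      refine intervalIntegral.continuous_parametric_intervalIntegral_of_continuous' ?_ 0 ω
      simp only [Function.uncurry_def]
      refine Continuous.mul (by fun_prop) ?_
      exact hG.comp (by fun_prop : Continuous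
        fun p : ((C(AddCircle ω, ℝ) × C(AddCircle ω, ℝ)) × AddCircle ω) × ℝ =>
          (p.1.1, p.1.2 + (p.2 : AddCircle ω)))
    refine ⟨fun z => ⟨greenOp ω K (G z), hJ.comp (by fun_prop : Continuous fun s => (z, s))⟩,
      ContinuousMap.continuous_of_continuous_uncurry _ hJ, ?_, ?_⟩
    · intro z s
      exact greenOp_bounds hω hK (G z) (hGz z) (fun s => hb _) s
    · intro z t
      exact greenOp_deriv hω hK (G z) (hGz z) t
  obtain ⟨T₁, hT₁, hTb₁, hTd₁⟩ := comp θ₁ hθ₁ N₁ hN₁ hb₁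
  obtain ⟨T₂, hT₂, hTb₂, hTd₂⟩ := comp θ₂ hθ₂ N₂ hN₂ hb₂
  set L := K * M - K * m
  set S := {x : C(AddCircle ω, ℝ) | (∀ s, x s ∈ Icc m M) ∧
      ∀ t t' : ℝ, |x (t : AddCircle ω) - x (t' : AddCircle ω)| ≤ L * |t - t'|}
  have lip : ∀ (x : C(AddCircle ω, ℝ)) (n : ℝ → ℝ), (∀ s, m ≤ x s ∧ x s ≤ M) →
      (∀ t, K * m ≤ n t ∧ n t ≤ K * M) →
      (∀ t : ℝ, HasDerivAt (fun t : ℝ => x t) (n t - K * x t) t) → x ∈ S := by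
    intro x n hx hn hd
    refine ⟨fun s => hx s, fun t t' => ?_⟩
    refine Convex.norm_image_sub_le_of_norm_hasDerivWithin_le (f := fun t : ℝ => x t)
      (s := univ) (fun t _ => (hd t).hasDerivWithinAt) (fun t _ => ?_) convex_univ
      (mem_univ t') (mem_univ t)
    rw [Real.norm_eq_abs, abs_le]
    have h1 := mul_le_mul_of_nonneg_left (hx t).1 hK.le
    have h2 := mul_le_mul_of_nonneg_left (hx t).2 hK.le
    have h3 := hn t
    constructor <;> simp only [L] <;> linarith
  obtain ⟨z, hz⟩ := schauder_fix (fun z => (T₁ z, T₂ (z.2, z.1))) (by fun_prop) (S ×ˢ S)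
    ((compact_lip m M L).prod (compact_lip m M L))
    (fun z => ⟨lip _ _ (hTb₁ z) (fun t => hb₁ _) (hTd₁ z),
      lip _ _ (hTb₂ _) (fun t => hb₂ _) (hTd₂ _)⟩)
  have h1 : T₁ z = z.1 := congrArg Prod.fst hz
  have h2 : T₂ (z.2, z.1) = z.2 := congrArg Prod.snd hz
  have hb1 := hTb₁ z
  have hb2 := hTb₂ (z.2, z.1)
  have hd1 := hTd₁ z
  have hd2 := hTd₂ (z.2, z.1)
  rw [h1] at hb1 hd1
  rw [h2] at hb2 hd2
  exact ⟨z.1, z.2, hb1, hb2, hd1, hd2⟩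

end Green

section Application

theorem niceCoef_bounds {ω : ℝ} (hω : 0 < ω) {g : ℝ → ℝ} (hg : NiceCoef ω g) :
    0 < infC ω g ∧ ∀ t, infC ω g ≤ g t ∧ g t ≤ supC ω g := by
  obtain ⟨hc, hp, hpos⟩ := hg
  have hcomp : IsCompact (g '' Icc 0 ω) := isCompact_Icc.image hc
  have hne : (g '' Icc 0 ω).Nonempty := ⟨g 0, 0, ⟨le_rfl, hω.le⟩, rfl⟩
  constructor
  · obtain ⟨t, -, ht⟩ := hcomp.sInf_mem hne
    unfold infC
    rw [← ht]
    exact hpos t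
  · intro t
    obtain ⟨s, hs, hst⟩ := hp.exists_mem_Ico₀ hω t
    rw [hst]
    have : g s ∈ g '' Icc 0 ω := ⟨s, ⟨hs.1, hs.2.le⟩, rfl⟩
    exact ⟨csInf_le hcomp.bddBelow this, le_csSup hcomp.bddAbove this⟩

theorem niceCoef_lift {ω : ℝ} {g : ℝ → ℝ} (hg : NiceCoef ω g) :
    ∃ G : AddCircle ω → ℝ, Continuous G ∧ ∀ t : ℝ, G (t : AddCircle ω) = g t := by
  have hqm : Topology.IsQuotientMap (fun u : ℝ => (u : AddCircle ω)) := isQuotientMap_quotient_mk'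
  refine ⟨hg.2.1.lift, ?_, fun t => rfl⟩
  rw [hqm.continuous_iff]
  exact hg.1

/-- The right-hand side of one equation plus `K u`. -/
noncomputable def rhsN (K δ c b d e u v w : ℝ) : ℝ :=
  K * u - δ * u / (c + u) + b * (v * Real.exp (-v)) + d * w / (e + w)

theorem frac_mono {a c c' u u' : ℝ} (hc : 0 < c) (ha : 0 ≤ a) (hcc : c ≤ c') (hu : 0 ≤ u')
    (huu : u' ≤ u) : a * u' / (c' + u') ≤ a * u / (c + u) := by
  rw [div_le_div_iff₀ (by linarith) (by linarith)]
  have h1 : u' * c ≤ u * c' := mul_le_mul huu hcc hc.le (by linarith)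
  nlinarith [mul_le_mul_of_nonneg_left h1 ha]

theorem K_mono {K δ c u u' : ℝ} (hc : 0 < c) (hδ : 0 ≤ δ) (hK : δ ≤ K * c) (hu : 0 ≤ u')
    (huu : u' ≤ u) : K * u' - δ * u' / (c + u') ≤ K * u - δ * u / (c + u) := by
  have h1 : δ * u / (c + u) - δ * u' / (c + u') = (u - u') * (δ * c / ((c + u) * (c + u'))) := by
    have : c + u ≠ 0 := by linarith
    have : c + u' ≠ 0 := by linarith
    field_simp
    ring
  have hK0 : 0 ≤ K := by
    by_contra h
    push Not at h
    nlinarith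
  have h2 : δ * c / ((c + u) * (c + u')) ≤ K := by
    rw [div_le_iff₀ (mul_pos (by linarith) (by linarith))]
    have h3 : c * c ≤ (c + u) * (c + u') :=
      mul_le_mul (by linarith) (by linarith) hc.le (by linarith)
    nlinarith [mul_le_mul_of_nonneg_left h3 hK0]
  nlinarith [mul_le_mul_of_nonneg_left h2 (sub_nonneg.2 huu)]

theorem ricker_le (v : ℝ) : v * Real.exp (-v) ≤ 1 / Real.exp 1 := by
  have h := Real.add_one_le_exp (v - 1)
  have h2 : v ≤ Real.exp (v - 1) := by linarith
  have := mul_le_mul_of_nonneg_right h2 (Real.exp_pos (-v)).le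
  rw [← Real.exp_add] at this
  rw [one_div, ← Real.exp_neg]
  calc _ ≤ _ := this
    _ = _ := by congr 1; ring

theorem ricker_ge {m M v : ℝ} (hm : 0 < m) (hmv : m ≤ v) (hvM : v ≤ M)
    (h : m * Real.exp (-m) ≤ M * Real.exp (-M)) : m * Real.exp (-m) ≤ v * Real.exp (-v) := by
  have hd : ∀ x : ℝ, HasDerivAt (fun x : ℝ => x * Real.exp (-x)) ((1 - x) * Real.exp (-x)) x := by
    intro x
    have h1 : HasDerivAt (fun x : ℝ => Real.exp (-x)) (Real.exp (-x) * (-1)) x :=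
      ((hasDerivAt_id x).neg).exp
    refine ((hasDerivAt_id x).mul h1).congr_deriv ?_
    simp only [id]
    ring
  have hcont : Continuous (fun x : ℝ => x * Real.exp (-x)) := by fun_prop
  rcases le_total v 1 with hv | hv
  · have hmono : MonotoneOn (fun x : ℝ => x * Real.exp (-x)) (Iic 1) := by
      refine monotoneOn_of_deriv_nonneg (convex_Iic 1) hcont.continuousOn
        (fun x _ => (hd x).differentiableAt.differentiableWithinAt) fun x hx => ?_
      rw [(hd x).deriv]
      simp only [interior_Iic, mem_Iio] at hx
      exact mul_nonneg (by linarith) (Real.exp_pos _).le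
    exact hmono (show m ≤ 1 by linarith) hv hmv
  · have hanti : AntitoneOn (fun x : ℝ => x * Real.exp (-x)) (Ici 1) := by
      refine antitoneOn_of_deriv_nonpos (convex_Ici 1) hcont.continuousOn
        (fun x _ => (hd x).differentiableAt.differentiableWithinAt) fun x hx => ?_
      rw [(hd x).deriv]
      simp only [interior_Ici, mem_Ioi] at hx
      exact mul_nonpos_of_nonpos_of_nonneg (by linarith) (Real.exp_pos _).le
    exact h.trans (hanti hv (show (1 : ℝ) ≤ M by linarith) hvM)

theorem rhsN_bounds {K δ c b d e u v w m M δm δM cm cM bm bM dm dM em eM : ℝ}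
    (hδm : 0 < δm) (hcm : 0 < cm) (hbm : 0 < bm) (hdm : 0 < dm) (hem : 0 < em)
    (hδ : δm ≤ δ ∧ δ ≤ δM) (hc : cm ≤ c ∧ c ≤ cM) (hb : bm ≤ b ∧ b ≤ bM)
    (hd : dm ≤ d ∧ d ≤ dM) (he : em ≤ e ∧ e ≤ eM) (hK : δM ≤ K * cm) (hK0 : 0 < K)
    (hm : 0 < m) (hu : m ≤ u ∧ u ≤ M) (hv : m ≤ v ∧ v ≤ M) (hw : m ≤ w ∧ w ≤ M)
    (hf : m * Real.exp (-m) ≤ M * Real.exp (-M))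
    (hup : bM / Real.exp 1 + dM ≤ δm * M / (cM + M))
    (hlo : δM / (cm + m) ≤ bm * Real.exp (-m) + dm / (eM + m)) :
    K * m ≤ rhsN K δ c b d e u v w ∧ rhsN K δ c b d e u v w ≤ K * M := by
  have hKc : δ ≤ K * c := by nlinarith
  have hc0 : 0 < c := by linarith
  have hδ0 : 0 < δ := by linarith
  have hM : 0 < M := by linarith
  have he0 : 0 < e := by linarith
  unfold rhsN
  constructor
  · have h1 := K_mono hc0 hδ0.le hKc hm.le hu.1
    have h2 : δ * m / (c + m) ≤ δM / (cm + m) * m := by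
      rw [div_mul_eq_mul_div]
      exact div_le_div₀ (by nlinarith) (mul_le_mul_of_nonneg_right hδ.2 hm.le) (by linarith) (by linarith)
    have h3 : bm * (m * Real.exp (-m)) ≤ b * (v * Real.exp (-v)) :=
      mul_le_mul hb.1 (ricker_ge hm hv.1 hv.2 hf) (by positivity) (by linarith)
    have h4 : dm * m / (eM + m) ≤ d * w / (e + w) :=
      (frac_mono he0 hdm.le he.2 hm.le hw.1).trans
        (div_le_div_of_nonneg_right (mul_le_mul_of_nonneg_right hd.1 (by linarith)) (by linarith))
    have h5 := mul_le_mul_of_nonneg_right hlo hm.le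
    have h6 : dm / (eM + m) * m = dm * m / (eM + m) := by ring
    rw [add_mul, h6] at h5
    nlinarith
  · have h1 := K_mono hc0 hδ0.le hKc (by linarith) hu.2
    have h2 : δm * M / (cM + M) ≤ δ * M / (c + M) :=
      div_le_div₀ (by positivity) (mul_le_mul_of_nonneg_right hδ.1 hM.le) (by linarith) (by linarith)
    have h3 : b * (v * Real.exp (-v)) ≤ bM / Real.exp 1 := by
      have := mul_le_mul hb.2 (ricker_le v) (mul_nonneg (by linarith) (Real.exp_pos _).le)
        (by linarith)
      calc _ ≤ _ := this
        _ = _ := by ring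
    have h4 : d * w / (e + w) ≤ dM := by
      rw [div_le_iff₀ (by linarith)]
      nlinarith
    linarith

theorem ev_up {δm cM A : ℝ} (h : A < δm) :
    ∀ᶠ M in Filter.atTop, A ≤ δm * M / (cM + M) := by
  have h1 : Filter.Tendsto (fun M : ℝ => δm - δm * cM / (cM + M)) Filter.atTop (nhds (δm - 0)) := by
    refine tendsto_const_nhds.sub ?_
    exact Filter.Tendsto.const_div_atTop (Filter.tendsto_atTop_add_const_left _ _ Filter.tendsto_id) _
  rw [sub_zero] at h1
  filter_upwards [h1.eventually (lt_mem_nhds h), Filter.eventually_gt_atTop (-cM)] with M hM hM2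
  have : cM + M ≠ 0 := by linarith
  have h3 : δm * M / (cM + M) = δm - δm * cM / (cM + M) := by
    field_simp
    ring
  rw [h3]
  exact hM.le

theorem ev_lo {δM cm bm dm eM : ℝ} (hcm : 0 < cm) (heM : 0 < eM) (h : δM / cm - dm / eM < bm) :
    ∀ᶠ m in nhdsWithin (0 : ℝ) (Ioi 0), δM / (cm + m) ≤ bm * Real.exp (-m) + dm / (eM + m) := by
  apply Filter.Eventually.filter_mono nhdsWithin_le_nhds
  have h1 : ContinuousAt (fun m : ℝ => δM / (cm + m)) 0 :=
    ContinuousAt.div (by fun_prop) (by fun_prop) (by simpa using hcm.ne')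
  have h2 : ContinuousAt (fun m : ℝ => bm * Real.exp (-m) + dm / (eM + m)) 0 :=
    ContinuousAt.add (by fun_prop)
      (ContinuousAt.div (by fun_prop) (by fun_prop) (by simpa using heM.ne'))
  have := h1.eventually_lt h2 (by simp; linarith)
  exact this.mono fun _ h => h.le

end Application

/-- Existence of a positive ω-periodic solution of the Nicholson-type system
with nonlinear density-dependent mortality, under (H1)–(H4). -/
theorem nicholson_periodic_solution
    (ω : ℝ) (hω : 0 < ω)
    (δ₁₁ δ₁₂ δ₂₁ δ₂₂ c₁₁ c₁₂ c₂₁ c₂₂ b₁ b₂ τ₁ τ₂ : ℝ → ℝ)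
    (hδ₁₁ : NiceCoef ω δ₁₁) (hδ₁₂ : NiceCoef ω δ₁₂)
    (hδ₂₁ : NiceCoef ω δ₂₁) (hδ₂₂ : NiceCoef ω δ₂₂)
    (hc₁₁ : NiceCoef ω c₁₁) (hc₁₂ : NiceCoef ω c₁₂)
    (hc₂₁ : NiceCoef ω c₂₁) (hc₂₂ : NiceCoef ω c₂₂)
    (hb₁ : NiceCoef ω b₁) (hb₂ : NiceCoef ω b₂)
    (hτ₁ : NiceCoef ω τ₁) (hτ₂ : NiceCoef ω τ₂)
    (H1 : supC ω b₁ / Real.exp 1 + supC ω δ₁₂ < infC ω δ₁₁)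
    (H2 : supC ω b₂ / Real.exp 1 + supC ω δ₂₁ < infC ω δ₂₂)
    (H3 : supC ω δ₁₁ / infC ω c₁₁ - infC ω δ₁₂ / supC ω c₁₂ < infC ω b₁)
    (H4 : supC ω δ₂₂ / infC ω c₂₂ - infC ω δ₂₁ / supC ω c₂₁ < infC ω b₂) :
    ∃ x₁ x₂ : ℝ → ℝ,
      Differentiable ℝ x₁ ∧ Differentiable ℝ x₂ ∧
      Function.Periodic x₁ ω ∧ Function.Periodic x₂ ω ∧
      (∀ t, 0 < x₁ t) ∧ (∀ t, 0 < x₂ t) ∧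
      (∀ t, deriv x₁ t =
        -(δ₁₁ t * x₁ t / (c₁₁ t + x₁ t))
          + b₁ t * (x₁ (t - τ₁ t) * Real.exp (-(x₁ (t - τ₁ t))))
          + δ₁₂ t * x₂ t / (c₁₂ t + x₂ t)) ∧
      (∀ t, deriv x₂ t =
        -(δ₂₂ t * x₂ t / (c₂₂ t + x₂ t))
          + b₂ t * (x₂ (t - τ₂ t) * Real.exp (-(x₂ (t - τ₂ t))))
          + δ₂₁ t * x₁ t / (c₂₁ t + x₁ t)) := by
  haveI : Fact (0 < ω) := ⟨hω⟩
  have hcoe : Continuous (fun u : ℝ => (u : AddCircle ω)) := AddCircle.continuous_mk' ω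
  obtain ⟨pδ₁₁, Bδ₁₁⟩ := niceCoef_bounds hω hδ₁₁
  obtain ⟨pδ₁₂, Bδ₁₂⟩ := niceCoef_bounds hω hδ₁₂
  obtain ⟨pδ₂₁, Bδ₂₁⟩ := niceCoef_bounds hω hδ₂₁
  obtain ⟨pδ₂₂, Bδ₂₂⟩ := niceCoef_bounds hω hδ₂₂
  obtain ⟨pc₁₁, Bc₁₁⟩ := niceCoef_bounds hω hc₁₁
  obtain ⟨pc₁₂, Bc₁₂⟩ := niceCoef_bounds hω hc₁₂
  obtain ⟨pc₂₁, Bc₂₁⟩ := niceCoef_bounds hω hc₂₁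
  obtain ⟨pc₂₂, Bc₂₂⟩ := niceCoef_bounds hω hc₂₂
  obtain ⟨pb₁, Bb₁⟩ := niceCoef_bounds hω hb₁
  obtain ⟨pb₂, Bb₂⟩ := niceCoef_bounds hω hb₂
  have qc₁₂ : 0 < supC ω c₁₂ := pc₁₂.trans_le ((Bc₁₂ 0).1.trans (Bc₁₂ 0).2)
  have qc₂₁ : 0 < supC ω c₂₁ := pc₂₁.trans_le ((Bc₂₁ 0).1.trans (Bc₂₁ 0).2)
  have qδ₁₁ : 0 < supC ω δ₁₁ := pδ₁₁.trans_le ((Bδ₁₁ 0).1.trans (Bδ₁₁ 0).2)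
  have qδ₂₂ : 0 < supC ω δ₂₂ := pδ₂₂.trans_le ((Bδ₂₂ 0).1.trans (Bδ₂₂ 0).2)
  -- the box
  obtain ⟨M, ⟨hM1, hM2⟩, hM0⟩ := (((ev_up (cM := supC ω c₁₁) H1).and
    (ev_up (cM := supC ω c₂₂) H2)).and (Filter.eventually_gt_atTop (0 : ℝ))).exists
  have hfM : ∀ᶠ m in nhdsWithin (0 : ℝ) (Ioi 0), m * Real.exp (-m) ≤ M * Real.exp (-M) := by
    apply Filter.Eventually.filter_mono nhdsWithin_le_nhds
    have h1 : Continuous (fun m : ℝ => m * Real.exp (-m)) := by fun_prop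
    have h2 := h1.tendsto 0
    simp only [zero_mul] at h2
    exact (h2.eventually (gt_mem_nhds (by positivity : 0 < M * Real.exp (-M)))).mono fun _ h => h.le
  have hmM : ∀ᶠ m in nhdsWithin (0 : ℝ) (Ioi 0), m ≤ M := by
    apply Filter.Eventually.filter_mono nhdsWithin_le_nhds
    exact (gt_mem_nhds hM0).mono fun _ h => le_of_lt h
  obtain ⟨m, ⟨⟨⟨hm1, hm2⟩, hf⟩, hmM⟩, hm0⟩ := (((((ev_lo pc₁₁ qc₁₂ H3).and
    (ev_lo pc₂₂ qc₂₁ H4)).and hfM).and hmM).and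
      (eventually_mem_nhdsWithin : ∀ᶠ m in nhdsWithin (0 : ℝ) (Ioi 0), m ∈ Ioi (0 : ℝ))).exists
  have hm : 0 < m := hm0
  set K := supC ω δ₁₁ / infC ω c₁₁ + supC ω δ₂₂ / infC ω c₂₂ with hKdef
  have hA : 0 < supC ω δ₁₁ / infC ω c₁₁ := by positivity
  have hB : 0 < supC ω δ₂₂ / infC ω c₂₂ := by positivity
  have hK : 0 < K := by positivity
  have hK1 : supC ω δ₁₁ ≤ K * infC ω c₁₁ := by
    rw [← div_le_iff₀ pc₁₁]; linarith
  have hK2 : supC ω δ₂₂ ≤ K * infC ω c₂₂ := by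
    rw [← div_le_iff₀ pc₂₂]; linarith
  -- lifts to the circle
  obtain ⟨Dδ₁₁, Cδ₁₁, Lδ₁₁⟩ := niceCoef_lift hδ₁₁
  obtain ⟨Dδ₁₂, Cδ₁₂, Lδ₁₂⟩ := niceCoef_lift hδ₁₂
  obtain ⟨Dδ₂₁, Cδ₂₁, Lδ₂₁⟩ := niceCoef_lift hδ₂₁
  obtain ⟨Dδ₂₂, Cδ₂₂, Lδ₂₂⟩ := niceCoef_lift hδ₂₂
  obtain ⟨Dc₁₁, Cc₁₁, Lc₁₁⟩ := niceCoef_lift hc₁₁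
  obtain ⟨Dc₁₂, Cc₁₂, Lc₁₂⟩ := niceCoef_lift hc₁₂
  obtain ⟨Dc₂₁, Cc₂₁, Lc₂₁⟩ := niceCoef_lift hc₂₁
  obtain ⟨Dc₂₂, Cc₂₂, Lc₂₂⟩ := niceCoef_lift hc₂₂
  obtain ⟨Db₁, Cb₁, Lb₁⟩ := niceCoef_lift hb₁
  obtain ⟨Db₂, Cb₂, Lb₂⟩ := niceCoef_lift hb₂
  obtain ⟨Dτ₁, Cτ₁, Lτ₁⟩ := niceCoef_lift hτ₁
  obtain ⟨Dτ₂, Cτ₂, Lτ₂⟩ := niceCoef_lift hτ₂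
  let cl : ℝ → ℝ := fun u => max m (min M u)
  have hcl : Continuous cl := by fun_prop
  have hclb : ∀ u, m ≤ cl u ∧ cl u ≤ M := fun u =>
    ⟨le_max_left _ _, max_le hmM (min_le_left _ _)⟩
  have hclid : ∀ u, m ≤ u ∧ u ≤ M → cl u = u := by
    rintro u ⟨h1, h2⟩
    simp only [cl]
    rw [min_eq_right h2, max_eq_right h1]
  have hNc : ∀ (δ c b d e : AddCircle ω → ℝ), Continuous δ → Continuous c → Continuous b →
      Continuous d → Continuous e → (∀ s, 0 < c s) → (∀ s, 0 < e s) →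
      Continuous (fun p : AddCircle ω × ℝ × ℝ × ℝ =>
        rhsN K (δ p.1) (c p.1) (b p.1) (d p.1) (e p.1) (cl p.2.1) (cl p.2.2.1) (cl p.2.2.2)) := by
    intro δ c b d e h1 h2 h3 h4 h5 h6 h7
    unfold rhsN
    refine ((Continuous.sub (by fun_prop) (Continuous.div (by fun_prop) (by fun_prop) ?_)).add
      (by fun_prop)).add (Continuous.div (by fun_prop) (by fun_prop) ?_)
    · intro p
      have := h6 p.1
      have := (hclb p.2.1).1
      linarith
    · intro p
      have := h7 p.1
      have := (hclb p.2.2.2).1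
      linarith
  have hpos : ∀ (D : AddCircle ω → ℝ) (g : ℝ → ℝ), (∀ t : ℝ, D (t : AddCircle ω) = g t) →
      (∀ t, 0 < g t) → ∀ s, 0 < D s := by
    intro D g h1 h2 s
    obtain ⟨t, rfl⟩ := QuotientAddGroup.mk_surjective s
    exact (h1 t).symm ▸ h2 t
  obtain ⟨x, y, hx, hy, hdx, hdy⟩ := abs_periodic (ω := ω) (m := m) (M := M) hK
    (fun s => s - ((Dτ₁ s : ℝ) : AddCircle ω)) (fun s => s - ((Dτ₂ s : ℝ) : AddCircle ω))
    (by fun_prop) (by fun_prop) _ _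
    (hNc Dδ₁₁ Dc₁₁ Db₁ Dδ₁₂ Dc₁₂ Cδ₁₁ Cc₁₁ Cb₁ Cδ₁₂ Cc₁₂
      (hpos _ _ Lc₁₁ hc₁₁.2.2) (hpos _ _ Lc₁₂ hc₁₂.2.2))
    (hNc Dδ₂₂ Dc₂₂ Db₂ Dδ₂₁ Dc₂₁ Cδ₂₂ Cc₂₂ Cb₂ Cδ₂₁ Cc₂₁
      (hpos _ _ Lc₂₂ hc₂₂.2.2) (hpos _ _ Lc₂₁ hc₂₁.2.2))
    (by
      rintro ⟨s, u, v, w⟩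
      obtain ⟨t, rfl⟩ := QuotientAddGroup.mk_surjective s
      refine rhsN_bounds pδ₁₁ pc₁₁ pb₁ pδ₁₂ pc₁₂ ?_ ?_ ?_ ?_ ?_ hK1 hK hm (hclb _) (hclb _) (hclb _)
        hf hM1 hm1
      · exact (Lδ₁₁ t).symm ▸ Bδ₁₁ t
      · exact (Lc₁₁ t).symm ▸ Bc₁₁ t
      · exact (Lb₁ t).symm ▸ Bb₁ t
      · exact (Lδ₁₂ t).symm ▸ Bδ₁₂ t
      · exact (Lc₁₂ t).symm ▸ Bc₁₂ t)
    (by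
      rintro ⟨s, u, v, w⟩
      obtain ⟨t, rfl⟩ := QuotientAddGroup.mk_surjective s
      refine rhsN_bounds pδ₂₂ pc₂₂ pb₂ pδ₂₁ pc₂₁ ?_ ?_ ?_ ?_ ?_ hK2 hK hm (hclb _) (hclb _) (hclb _)
        hf hM2 hm2
      · exact (Lδ₂₂ t).symm ▸ Bδ₂₂ t
      · exact (Lc₂₂ t).symm ▸ Bc₂₂ t
      · exact (Lb₂ t).symm ▸ Bb₂ t
      · exact (Lδ₂₁ t).symm ▸ Bδ₂₁ t
      · exact (Lc₂₁ t).symm ▸ Bc₂₁ t)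
  refine ⟨fun t => x (t : AddCircle ω), fun t => y (t : AddCircle ω),
    fun t => (hdx t).differentiableAt, fun t => (hdy t).differentiableAt,
    fun t => by simp only [AddCircle.coe_add_period], fun t => by simp only [AddCircle.coe_add_period],
    fun t => hm.trans_le (hx _).1, fun t => hm.trans_le (hy _).1, ?_, ?_⟩
  · intro t
    rw [(hdx t).deriv]
    simp only [hclid _ (hx _), hclid _ (hy _), Lδ₁₁, Lc₁₁, Lb₁, Lδ₁₂, Lc₁₂, Lτ₁, rhsN,
      AddCircle.coe_sub]
    ring
  · intro t
    rw [(hdy t).deriv]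
    simp only [hclid _ (hx _), hclid _ (hy _), Lδ₂₂, Lc₂₂, Lb₂, Lδ₂₁, Lc₂₁, Lτ₂, rhsN,
      AddCircle.coe_sub]
    ring
end

section
/- Let λ ∈ (0,1) and let (x₁, x₂) be a positive ω-periodic differentiable solution of the λ-parametrized system. If x₁ attains its maximum value R := x₁⁺ at a point ξ ∈ [0,ω], then δ₁₁(ξ)R/(c₁₁(ξ)+R) = b₁(ξ)f(x₁(ξ−τ₁(ξ))) + δ₁₂(ξ)x₂(ξ)/(c₁₂(ξ)+x₂(ξ)), and consequently δ₁₁⁻ R/(c₁₁⁺ + R) < b₁⁺/e + δ₁₂⁺. -/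
open Real Set

/-- `(x₁, x₂)` is a positive ω-periodic differentiable solution of the
λ-parametrized Nicholson-type system. -/
def IsLamSol (ω : ℝ) (δ₁₁ δ₁₂ δ₂₁ δ₂₂ c₁₁ c₁₂ c₂₁ c₂₂ b₁ b₂ τ₁ τ₂ : ℝ → ℝ)
    (lam : ℝ) (x₁ x₂ : ℝ → ℝ) : Prop :=
  Differentiable ℝ x₁ ∧ Differentiable ℝ x₂ ∧
  Function.Periodic x₁ ω ∧ Function.Periodic x₂ ω ∧
  (∀ t, 0 < x₁ t) ∧ (∀ t, 0 < x₂ t) ∧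
  (∀ t, deriv x₁ t = lam *
    (-(δ₁₁ t * x₁ t / (c₁₁ t + x₁ t))
      + b₁ t * (x₁ (t - τ₁ t) * Real.exp (-(x₁ (t - τ₁ t))))
      + δ₁₂ t * x₂ t / (c₁₂ t + x₂ t))) ∧
  (∀ t, deriv x₂ t = lam *
    (-(δ₂₂ t * x₂ t / (c₂₂ t + x₂ t))
      + b₂ t * (x₂ (t - τ₂ t) * Real.exp (-(x₂ (t - τ₂ t))))
      + δ₂₁ t * x₁ t / (c₂₁ t + x₁ t)))

theorem le_supC_aux (ω : ℝ) (g : ℝ → ℝ) (hg : Continuous g) (t : ℝ) (ht : t ∈ Icc 0 ω) :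
    g t ≤ supC ω g :=
  le_csSup (isCompact_Icc.image hg).bddAbove (mem_image_of_mem g ht)

theorem infC_le_aux (ω : ℝ) (g : ℝ → ℝ) (hg : Continuous g) (t : ℝ) (ht : t ∈ Icc 0 ω) :
    infC ω g ≤ g t :=
  csInf_le (isCompact_Icc.image hg).bddBelow (mem_image_of_mem g ht)

/-- At a maximum point ξ of x₁, the first equation of the
λ-system yields the balance identity and the a priori upper-bound inequality. -/
theorem nicholson_max_point_identity
    (ω : ℝ) (hω : 0 < ω)
    (δ₁₁ δ₁₂ δ₂₁ δ₂₂ c₁₁ c₁₂ c₂₁ c₂₂ b₁ b₂ τ₁ τ₂ : ℝ → ℝ)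
    (hδ₁₁ : NiceCoef ω δ₁₁) (hδ₁₂ : NiceCoef ω δ₁₂)
    (hδ₂₁ : NiceCoef ω δ₂₁) (hδ₂₂ : NiceCoef ω δ₂₂)
    (hc₁₁ : NiceCoef ω c₁₁) (hc₁₂ : NiceCoef ω c₁₂)
    (hc₂₁ : NiceCoef ω c₂₁) (hc₂₂ : NiceCoef ω c₂₂)
    (hb₁ : NiceCoef ω b₁) (hb₂ : NiceCoef ω b₂)
    (hτ₁ : NiceCoef ω τ₁) (hτ₂ : NiceCoef ω τ₂)
    (lam : ℝ) (hlam : lam ∈ Ioo (0:ℝ) 1)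
    (x₁ x₂ : ℝ → ℝ)
    (hsol : IsLamSol ω δ₁₁ δ₁₂ δ₂₁ δ₂₂ c₁₁ c₁₂ c₂₁ c₂₂ b₁ b₂ τ₁ τ₂ lam x₁ x₂)
    (R : ℝ) (hR : R = supC ω x₁)
    (ξ : ℝ) (hξ : ξ ∈ Icc 0 ω) (hmax : x₁ ξ = R) :
    δ₁₁ ξ * R / (c₁₁ ξ + R) =
        b₁ ξ * (x₁ (ξ - τ₁ ξ) * Real.exp (-(x₁ (ξ - τ₁ ξ))))
          + δ₁₂ ξ * x₂ ξ / (c₁₂ ξ + x₂ ξ) ∧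
      infC ω δ₁₁ * R / (supC ω c₁₁ + R) < supC ω b₁ / Real.exp 1 + supC ω δ₁₂ := by
  obtain ⟨hd1, -, hp1, -, hx1, hx2, he, -⟩ := hsol
  have hglob : ∀ t, x₁ t ≤ x₁ ξ := by
    intro t
    obtain ⟨s, hs, hst⟩ := hp1.exists_mem_Ico₀ hω t
    rw [hst, hmax, hR]
    exact le_supC_aux ω x₁ hd1.continuous s ⟨hs.1, hs.2.le⟩
  have hder : deriv x₁ ξ = 0 :=
    IsLocalMax.deriv_eq_zero (Filter.Eventually.of_forall hglob)
  have h1 := he ξ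
  rw [hder, hmax] at h1
  have h2 := (mul_eq_zero.mp h1.symm).resolve_left hlam.1.ne'
  have hid : δ₁₁ ξ * R / (c₁₁ ξ + R) =
        b₁ ξ * (x₁ (ξ - τ₁ ξ) * Real.exp (-(x₁ (ξ - τ₁ ξ))))
          + δ₁₂ ξ * x₂ ξ / (c₁₂ ξ + x₂ ξ) := by linarith
  refine ⟨hid, ?_⟩
  have hRpos : 0 < R := hmax ▸ hx1 ξ
  have hcpos := hc₁₁.2.2 ξ
  have hA : infC ω δ₁₁ * R / (supC ω c₁₁ + R) ≤ δ₁₁ ξ * R / (c₁₁ ξ + R) := by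
    have hi := infC_le_aux ω δ₁₁ hδ₁₁.1 ξ hξ
    have hc := le_supC_aux ω c₁₁ hc₁₁.1 ξ hξ
    have hdp := hδ₁₁.2.2 ξ
    apply div_le_div₀
    · positivity
    · exact mul_le_mul_of_nonneg_right hi hRpos.le
    · positivity
    · linarith
  have hB : b₁ ξ * (x₁ (ξ - τ₁ ξ) * Real.exp (-(x₁ (ξ - τ₁ ξ)))) ≤ supC ω b₁ / Real.exp 1 := by
    have hb := le_supC_aux ω b₁ hb₁.1 ξ hξ
    have hbp := hb₁.2.2 ξ
    generalize x₁ (ξ - τ₁ ξ) = u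
    have hf : u * Real.exp (-u) ≤ Real.exp (-1) := by
      have h3 : u ≤ Real.exp (u - 1) := by linarith [Real.add_one_le_exp (u - 1)]
      calc u * Real.exp (-u) ≤ Real.exp (u - 1) * Real.exp (-u) :=
            mul_le_mul_of_nonneg_right h3 (Real.exp_pos _).le
        _ = Real.exp (-1) := by rw [← Real.exp_add]; congr 1; ring
    rw [div_eq_mul_inv, ← Real.exp_neg]
    calc b₁ ξ * (u * Real.exp (-u)) ≤ b₁ ξ * Real.exp (-1) :=
          mul_le_mul_of_nonneg_left hf hbp.le
      _ ≤ _ := mul_le_mul_of_nonneg_right hb (Real.exp_pos _).le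
  have hC : δ₁₂ ξ * x₂ ξ / (c₁₂ ξ + x₂ ξ) < supC ω δ₁₂ := by
    have hd := le_supC_aux ω δ₁₂ hδ₁₂.1 ξ hξ
    have hdp := hδ₁₂.2.2 ξ
    have hcp := hc₁₂.2.2 ξ
    have hxp := hx2 ξ
    refine lt_of_lt_of_le ?_ hd
    rw [div_lt_iff₀ (by positivity)]
    nlinarith [mul_pos hdp hcp]
  linarith
end

section
/- Assume (H1): b₁⁺/e + δ₁₂⁺ < δ₁₁⁻. Then there exists R₀* > 0 such that for every λ ∈ (0,1) and every positive ω-periodic differentiable solution (x₁, x₂) of the λ-parametrized system, one has x₁(t) < R₀* for all t ∈ ℝ. -/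
open Real Set

theorem nice_le_supC (ω : ℝ) (hω : 0 < ω) (g : ℝ → ℝ) (hg : NiceCoef ω g) (t : ℝ) :
    g t ≤ supC ω g := by
  obtain ⟨s, hs, he⟩ := hg.2.1.exists_mem_Ico₀ hω t
  rw [he]
  exact le_csSup (isCompact_Icc.image hg.1).bddAbove ⟨s, ⟨hs.1, hs.2.le⟩, rfl⟩

theorem nice_infC_le (ω : ℝ) (hω : 0 < ω) (g : ℝ → ℝ) (hg : NiceCoef ω g) (t : ℝ) :
    infC ω g ≤ g t := by
  obtain ⟨s, hs, he⟩ := hg.2.1.exists_mem_Ico₀ hω t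
  rw [he]
  exact csInf_le (isCompact_Icc.image hg.1).bddBelow ⟨s, ⟨hs.1, hs.2.le⟩, rfl⟩

theorem mul_exp_neg_le_inv (y : ℝ) : y * Real.exp (-y) ≤ 1 / Real.exp 1 := by
  have h := Real.add_one_le_exp (y - 1)
  have h2 : Real.exp (y - 1) * Real.exp (-y) = 1 / Real.exp 1 := by
    rw [← Real.exp_add, one_div, ← Real.exp_neg]
    congr 1
    ring
  rw [← h2]
  exact mul_le_mul_of_nonneg_right (by linarith) (Real.exp_pos _).le

/-- A priori upper bound for x₁ under (H1). -/
theorem nicholson_apriori_upper_x1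
    (ω : ℝ) (hω : 0 < ω)
    (δ₁₁ δ₁₂ δ₂₁ δ₂₂ c₁₁ c₁₂ c₂₁ c₂₂ b₁ b₂ τ₁ τ₂ : ℝ → ℝ)
    (hδ₁₁ : NiceCoef ω δ₁₁) (hδ₁₂ : NiceCoef ω δ₁₂)
    (hδ₂₁ : NiceCoef ω δ₂₁) (hδ₂₂ : NiceCoef ω δ₂₂)
    (hc₁₁ : NiceCoef ω c₁₁) (hc₁₂ : NiceCoef ω c₁₂)
    (hc₂₁ : NiceCoef ω c₂₁) (hc₂₂ : NiceCoef ω c₂₂)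
    (hb₁ : NiceCoef ω b₁) (hb₂ : NiceCoef ω b₂)
    (hτ₁ : NiceCoef ω τ₁) (hτ₂ : NiceCoef ω τ₂)
    (H1 : supC ω b₁ / Real.exp 1 + supC ω δ₁₂ < infC ω δ₁₁) :
    ∃ R₀ : ℝ, 0 < R₀ ∧
      ∀ lam ∈ Ioo (0:ℝ) 1, ∀ x₁ x₂ : ℝ → ℝ,
        IsLamSol ω δ₁₁ δ₁₂ δ₂₁ δ₂₂ c₁₁ c₁₂ c₂₁ c₂₂ b₁ b₂ τ₁ τ₂ lam x₁ x₂ →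
        ∀ t : ℝ, x₁ t < R₀ := by
  have hBp : 0 < supC ω b₁ := (hb₁.2.2 0).trans_le (nice_le_supC ω hω b₁ hb₁ 0)
  have hdp : 0 < supC ω δ₁₂ := (hδ₁₂.2.2 0).trans_le (nice_le_supC ω hω δ₁₂ hδ₁₂ 0)
  have hCp : 0 < supC ω c₁₁ := (hc₁₁.2.2 0).trans_le (nice_le_supC ω hω c₁₁ hc₁₁ 0)
  set K := supC ω b₁ / Real.exp 1 + supC ω δ₁₂ with hK
  have hKp : 0 < K := by positivity
  have hDK : 0 < infC ω δ₁₁ - K := by linarith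
  refine ⟨K * supC ω c₁₁ / (infC ω δ₁₁ - K) + 1, by positivity, ?_⟩
  rintro lam ⟨hl, -⟩ x₁ x₂ ⟨hd, -, hp, -, hx, hy, he, -⟩ t
  obtain ⟨T, -, hT⟩ := (isCompact_Icc (a := (0:ℝ)) (b := ω)).exists_isMaxOn
    ⟨0, le_rfl, hω.le⟩ hd.continuous.continuousOn
  have hmax : ∀ s, x₁ s ≤ x₁ T := by
    intro s
    obtain ⟨r, hr, h⟩ := hp.exists_mem_Ico₀ hω s
    rw [h]
    exact hT ⟨hr.1, hr.2.le⟩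
  have hder : deriv x₁ T = 0 :=
    IsLocalMax.deriv_eq_zero (Filter.Eventually.of_forall hmax)
  have e := he T
  rw [hder] at e
  have e2 := (mul_eq_zero.mp e.symm).resolve_left hl.ne'
  have hM := hx T
  have hc := hc₁₁.2.2 T
  have hcC := nice_le_supC ω hω c₁₁ hc₁₁ T
  have hD := nice_infC_le ω hω δ₁₁ hδ₁₁ T
  have h1 : b₁ T * (x₁ (T - τ₁ T) * Real.exp (-(x₁ (T - τ₁ T)))) ≤ supC ω b₁ / Real.exp 1 := by
    rw [div_eq_mul_one_div]
    exact mul_le_mul (nice_le_supC ω hω b₁ hb₁ T) (mul_exp_neg_le_inv _)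
      (mul_nonneg (hx _).le (Real.exp_pos _).le) hBp.le
  have h2 : δ₁₂ T * x₂ T / (c₁₂ T + x₂ T) ≤ supC ω δ₁₂ := by
    have hy' := hy T
    have hc' := hc₁₂.2.2 T
    have hd' := hδ₁₂.2.2 T
    rw [div_le_iff₀ (by linarith)]
    have := nice_le_supC ω hω δ₁₂ hδ₁₂ T
    nlinarith [mul_pos hdp hc', mul_le_mul_of_nonneg_right this hy'.le]
  have h3 : δ₁₁ T * x₁ T / (c₁₁ T + x₁ T) ≤ K := by linarith
  rw [div_le_iff₀ (by linarith)] at h3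
  have h4 : x₁ T ≤ K * supC ω c₁₁ / (infC ω δ₁₁ - K) := by
    rw [le_div_iff₀ hDK]
    nlinarith [mul_le_mul_of_nonneg_right hD hM.le, mul_le_mul_of_nonneg_left hcC hKp.le]
  linarith [hmax t]
end

section
/- Assume (H1), (H2), (H3) and (H4). Then there exist constants 0 < ε₀ < R₀ such that for every λ ∈ (0,1) and every positive ω-periodic differentiable solution (x₁, x₂) of the λ-parametrized system, one has ε₀ < x₁(t) < R₀ and ε₀ < x₂(t) < R₀ for all t ∈ ℝ. -/
open Real Set

lemma coef_bds {ω : ℝ} (hω : 0 < ω) {g : ℝ → ℝ} (hg : NiceCoef ω g) :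
    0 < infC ω g ∧ 0 < supC ω g ∧ ∀ t, infC ω g ≤ g t ∧ g t ≤ supC ω g := by
  obtain ⟨hc, hp, hpos⟩ := hg
  have hK : IsCompact (g '' Icc 0 ω) := isCompact_Icc.image hc
  have hne : (g '' Icc 0 ω).Nonempty := ⟨g 0, 0, ⟨le_rfl, hω.le⟩, rfl⟩
  have hb : ∀ t, infC ω g ≤ g t ∧ g t ≤ supC ω g := by
    intro t
    obtain ⟨u, hu, hgu⟩ := hp.exists_mem_Ico₀ hω t
    have hm : g t ∈ g '' Icc 0 ω := ⟨u, ⟨hu.1, hu.2.le⟩, hgu.symm⟩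
    exact ⟨csInf_le hK.bddBelow hm, le_csSup hK.bddAbove hm⟩
  refine ⟨?_, (hpos 0).trans_le (hb 0).2, hb⟩
  obtain ⟨u, _, hu⟩ := hK.sInf_mem hne
  unfold infC
  rw [← hu]
  exact hpos u

lemma exists_ext {ω : ℝ} (hω : 0 < ω) {x : ℝ → ℝ} (hx : Differentiable ℝ x)
    (hp : Function.Periodic x ω) :
    (∃ t, (∀ u, x t ≤ x u) ∧ deriv x t = 0) ∧ (∃ t, (∀ u, x u ≤ x t) ∧ deriv x t = 0) := by
  have hne : (Icc 0 ω).Nonempty := ⟨0, le_rfl, hω.le⟩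
  constructor
  · obtain ⟨t, _, h⟩ := isCompact_Icc.exists_isMinOn hne hx.continuous.continuousOn
    have h' : ∀ u, x t ≤ x u := by
      intro u
      obtain ⟨v, hv, hxv⟩ := hp.exists_mem_Ico₀ hω u
      rw [hxv]
      exact h ⟨hv.1, hv.2.le⟩
    exact ⟨t, h', IsLocalMin.deriv_eq_zero (Filter.Eventually.of_forall h')⟩
  · obtain ⟨t, _, h⟩ := isCompact_Icc.exists_isMaxOn hne hx.continuous.continuousOn
    have h' : ∀ u, x u ≤ x t := by
      intro u
      obtain ⟨v, hv, hxv⟩ := hp.exists_mem_Ico₀ hω u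
      rw [hxv]
      exact h ⟨hv.1, hv.2.le⟩
    exact ⟨t, h', IsLocalMax.deriv_eq_zero (Filter.Eventually.of_forall h')⟩

lemma f_le (z : ℝ) : z * Real.exp (-z) ≤ 1 / Real.exp 1 := by
  have h := Real.add_one_le_exp (z - 1)
  have h2 : Real.exp (z - 1) * Real.exp (-z) = 1 / Real.exp 1 := by
    rw [← Real.exp_add, one_div, ← Real.exp_neg]; congr 1; ring
  rw [← h2]
  exact mul_le_mul_of_nonneg_right (by linarith) (Real.exp_pos _).le

lemma alg_upper {D C B E δ c b d k x y z : ℝ} (hx : 0 < x) (hy : 0 < y)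
    (hc : 0 < c) (hk : 0 < k) (hb : 0 < b) (hd : 0 < d)
    (hD : D ≤ δ) (hC : c ≤ C) (hB : b ≤ B) (hE : d ≤ E)
    (H : B / Real.exp 1 + E < D)
    (h : -(δ * x / (c + x)) + b * (z * Real.exp (-z)) + d * y / (k + y) = 0) :
    x ≤ (B / Real.exp 1 + E) * C / (D - (B / Real.exp 1 + E)) := by
  have h1 : b * (z * Real.exp (-z)) ≤ B / Real.exp 1 := by
    calc b * (z * Real.exp (-z)) ≤ b * (1 / Real.exp 1) :=
          mul_le_mul_of_nonneg_left (f_le z) hb.le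
      _ ≤ B * (1 / Real.exp 1) := mul_le_mul_of_nonneg_right hB (by positivity)
      _ = _ := by ring
  have h2 : d * y / (k + y) ≤ E := by
    rw [div_le_iff₀ (by positivity)]
    nlinarith [mul_pos hd hk, mul_nonneg (sub_nonneg.2 hE) (add_pos hk hy).le]
  have hQ : 0 < B / Real.exp 1 + E := by
    have : 0 < B := hb.trans_le hB
    have : 0 < E := hd.trans_le hE
    positivity
  set Q := B / Real.exp 1 + E with hQd
  have h3 : δ * x / (c + x) ≤ Q := by linarith
  rw [div_le_iff₀ (by positivity)] at h3
  rw [le_div_iff₀ (by linarith)]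
  nlinarith [mul_le_mul_of_nonneg_right hD hx.le, mul_le_mul_of_nonneg_left hC hQ.le]

lemma alg_lower {D C B E K R s δ c b d k x y z : ℝ} (hx : 0 < x) (hs : 0 < s)
    (hC0 : 0 < C) (hB0 : 0 < B) (hE0 : 0 < E) (hk : 0 < k) (hδ : 0 < δ)
    (hD : δ ≤ D) (hC : C ≤ c) (hB : B ≤ b) (hE : E ≤ d) (hK : k ≤ K)
    (hxy : x ≤ y) (hxz : x ≤ z) (hzR : z ≤ R)
    (H : D / C < B * Real.exp (-s) + E / (K + s))
    (h : -(δ * x / (c + x)) + b * (z * Real.exp (-z)) + d * y / (k + y) = 0) :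
    min s (s * Real.exp (s - R)) < x := by
  by_contra hcon
  push Not at hcon
  have hxs : x ≤ s := hcon.trans (min_le_left _ _)
  have hxs' : x ≤ s * Real.exp (s - R) := hcon.trans (min_le_right _ _)
  have hz : x * Real.exp (-s) ≤ z * Real.exp (-z) := by
    rcases le_total z s with hzs | hzs
    · exact mul_le_mul hxz (Real.exp_le_exp.2 (by linarith)) (Real.exp_pos _).le (by linarith)
    · calc x * Real.exp (-s) ≤ s * Real.exp (s - R) * Real.exp (-s) :=
            mul_le_mul_of_nonneg_right hxs' (Real.exp_pos _).le
        _ = s * Real.exp (-R) := by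
            rw [mul_assoc, ← Real.exp_add]; congr 2; ring
        _ ≤ z * Real.exp (-z) :=
            mul_le_mul hzs (Real.exp_le_exp.2 (by linarith)) (Real.exp_pos _).le (by linarith)
  have h1 : B * (x * Real.exp (-s)) ≤ b * (z * Real.exp (-z)) :=
    mul_le_mul hB hz (by positivity) (by linarith)
  have h2 : E * x / (K + s) ≤ d * y / (k + y) := by
    have e1 : E * x / (K + s) ≤ E * x / (k + x) :=
      div_le_div_of_nonneg_left (by positivity) (by positivity) (by linarith)
    have e2 : E * x / (k + x) ≤ d * y / (k + y) := by
      rw [div_le_div_iff₀ (by positivity) (by linarith)]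
      have : E * (x * (k + y)) ≤ d * (y * (k + x)) :=
        mul_le_mul hE (by nlinarith) (by nlinarith) (by linarith)
      nlinarith
    exact e1.trans e2
  have h3 : δ * x / (c + x) ≤ D * x / C := by
    apply div_le_div₀ (by nlinarith) (by nlinarith) hC0 (by linarith)
  have h4 := mul_lt_mul_of_pos_right H hx
  have e1 : D / C * x = D * x / C := by ring
  have e2 : (B * Real.exp (-s) + E / (K + s)) * x
    = B * (x * Real.exp (-s)) + E * x / (K + s) := by ring
  linarith

lemma exists_s {P B E K : ℝ} (hK : 0 < K) (H : P - E / K < B) :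
    ∃ s, 0 < s ∧ P < B * Real.exp (-s) + E / (K + s) := by
  have hc : ContinuousAt (fun s : ℝ => B * Real.exp (-s) + E / (K + s)) 0 := by
    apply ContinuousAt.add
    · fun_prop
    · apply ContinuousAt.div (by fun_prop) (by fun_prop)
      simpa using hK.ne'
  have h0 : P < (fun s : ℝ => B * Real.exp (-s) + E / (K + s)) 0 := by
    simp; linarith
  have hev := hc.eventually (lt_mem_nhds h0)
  have hev' : ∀ᶠ s in nhdsWithin (0:ℝ) (Ioi 0),
      P < B * Real.exp (-s) + E / (K + s) := hev.filter_mono nhdsWithin_le_nhds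
  obtain ⟨s, h1, h2⟩ := (hev'.and self_mem_nhdsWithin).exists
  exact ⟨s, h2, h1⟩

/-- Uniform a priori bounds under (H1)–(H4). -/
theorem nicholson_apriori_bounds
    (ω : ℝ) (hω : 0 < ω)
    (δ₁₁ δ₁₂ δ₂₁ δ₂₂ c₁₁ c₁₂ c₂₁ c₂₂ b₁ b₂ τ₁ τ₂ : ℝ → ℝ)
    (hδ₁₁ : NiceCoef ω δ₁₁) (hδ₁₂ : NiceCoef ω δ₁₂)
    (hδ₂₁ : NiceCoef ω δ₂₁) (hδ₂₂ : NiceCoef ω δ₂₂)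
    (hc₁₁ : NiceCoef ω c₁₁) (hc₁₂ : NiceCoef ω c₁₂)
    (hc₂₁ : NiceCoef ω c₂₁) (hc₂₂ : NiceCoef ω c₂₂)
    (hb₁ : NiceCoef ω b₁) (hb₂ : NiceCoef ω b₂)
    (hτ₁ : NiceCoef ω τ₁) (hτ₂ : NiceCoef ω τ₂)
    (H1 : supC ω b₁ / Real.exp 1 + supC ω δ₁₂ < infC ω δ₁₁)
    (H2 : supC ω b₂ / Real.exp 1 + supC ω δ₂₁ < infC ω δ₂₂)
    (H3 : supC ω δ₁₁ / infC ω c₁₁ - infC ω δ₁₂ / supC ω c₁₂ < infC ω b₁)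
    (H4 : supC ω δ₂₂ / infC ω c₂₂ - infC ω δ₂₁ / supC ω c₂₁ < infC ω b₂) :
    ∃ ε₀ R₀ : ℝ, 0 < ε₀ ∧ ε₀ < R₀ ∧
      ∀ lam ∈ Ioo (0:ℝ) 1, ∀ x₁ x₂ : ℝ → ℝ,
        IsLamSol ω δ₁₁ δ₁₂ δ₂₁ δ₂₂ c₁₁ c₁₂ c₂₁ c₂₂ b₁ b₂ τ₁ τ₂ lam x₁ x₂ →
        ∀ t : ℝ, ε₀ < x₁ t ∧ x₁ t < R₀ ∧ ε₀ < x₂ t ∧ x₂ t < R₀ := by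
  obtain ⟨pδ₁₁, -, Bδ₁₁⟩ := coef_bds hω hδ₁₁
  obtain ⟨pδ₁₂, -, Bδ₁₂⟩ := coef_bds hω hδ₁₂
  obtain ⟨pδ₂₁, -, Bδ₂₁⟩ := coef_bds hω hδ₂₁
  obtain ⟨pδ₂₂, -, Bδ₂₂⟩ := coef_bds hω hδ₂₂
  obtain ⟨pc₁₁, -, Bc₁₁⟩ := coef_bds hω hc₁₁
  obtain ⟨-, qc₁₂, Bc₁₂⟩ := coef_bds hω hc₁₂
  obtain ⟨-, qc₂₁, Bc₂₁⟩ := coef_bds hω hc₂₁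
  obtain ⟨pc₂₂, -, Bc₂₂⟩ := coef_bds hω hc₂₂
  obtain ⟨pb₁, -, Bb₁⟩ := coef_bds hω hb₁
  obtain ⟨pb₂, -, Bb₂⟩ := coef_bds hω hb₂
  obtain ⟨s₁, hs₁, Hs₁⟩ := exists_s qc₁₂ H3
  obtain ⟨s₂, hs₂, Hs₂⟩ := exists_s qc₂₁ H4
  obtain ⟨R₁, hR₁⟩ : ∃ R, R = (supC ω b₁ / Real.exp 1 + supC ω δ₁₂) * supC ω c₁₁ /
    (infC ω δ₁₁ - (supC ω b₁ / Real.exp 1 + supC ω δ₁₂)) := ⟨_, rfl⟩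
  obtain ⟨R₂, hR₂⟩ : ∃ R, R = (supC ω b₂ / Real.exp 1 + supC ω δ₂₁) * supC ω c₂₂ /
    (infC ω δ₂₂ - (supC ω b₂ / Real.exp 1 + supC ω δ₂₁)) := ⟨_, rfl⟩
  obtain ⟨ε₁, hε₁⟩ : ∃ e, e = min s₁ (s₁ * Real.exp (s₁ - R₁)) := ⟨_, rfl⟩
  obtain ⟨ε₂, hε₂⟩ : ∃ e, e = min s₂ (s₂ * Real.exp (s₂ - R₂)) := ⟨_, rfl⟩
  have pε₁ : 0 < ε₁ := by rw [hε₁]; exact lt_min hs₁ (by positivity)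
  have pε₂ : 0 < ε₂ := by rw [hε₂]; exact lt_min hs₂ (by positivity)
  refine ⟨min ε₁ ε₂, max (max R₁ R₂) (min ε₁ ε₂) + 1, lt_min pε₁ pε₂,
    (le_max_right _ _).trans_lt (lt_add_one _), ?_⟩
  intro lam hlam x₁ x₂ ⟨d₁, d₂, p₁, p₂, pos₁, pos₂, eq₁, eq₂⟩
  have hl : lam ≠ 0 := hlam.1.ne'
  obtain ⟨⟨m₁, hm₁, dm₁⟩, ⟨M₁, hM₁, dM₁⟩⟩ := exists_ext hω d₁ p₁
  obtain ⟨⟨m₂, hm₂, dm₂⟩, ⟨M₂, hM₂, dM₂⟩⟩ := exists_ext hω d₂ p₂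
  rw [eq₁, mul_eq_zero, or_iff_right hl] at dm₁ dM₁
  rw [eq₂, mul_eq_zero, or_iff_right hl] at dm₂ dM₂
  have U₁ : ∀ t, x₁ t ≤ R₁ := fun t => (hM₁ t).trans <| hR₁ ▸
    alg_upper (pos₁ _) (pos₂ _) (hc₁₁.2.2 _) (hc₁₂.2.2 _) (hb₁.2.2 _) (hδ₁₂.2.2 _)
      (Bδ₁₁ _).1 (Bc₁₁ _).2 (Bb₁ _).2 (Bδ₁₂ _).2 H1 dM₁
  have U₂ : ∀ t, x₂ t ≤ R₂ := fun t => (hM₂ t).trans <| hR₂ ▸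
    alg_upper (pos₂ _) (pos₁ _) (hc₂₂.2.2 _) (hc₂₁.2.2 _) (hb₂.2.2 _) (hδ₂₁.2.2 _)
      (Bδ₂₂ _).1 (Bc₂₂ _).2 (Bb₂ _).2 (Bδ₂₁ _).2 H2 dM₂
  have L : min ε₁ ε₂ < x₁ m₁ ∧ min ε₁ ε₂ < x₂ m₂ := by
    rcases le_total (x₁ m₁) (x₂ m₂) with h | h
    · have := alg_lower (pos₁ _) hs₁ pc₁₁ pb₁ pδ₁₂ (hc₁₂.2.2 _) (hδ₁₁.2.2 _)
        (Bδ₁₁ _).2 (Bc₁₁ _).1 (Bb₁ _).1 (Bδ₁₂ _).1 (Bc₁₂ _).2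
        (h.trans (hm₂ _)) (hm₁ _) (U₁ _) Hs₁ dm₁
      rw [← hε₁] at this
      have := (min_le_left ε₁ ε₂).trans_lt this
      exact ⟨this, this.trans_le h⟩
    · have := alg_lower (pos₂ _) hs₂ pc₂₂ pb₂ pδ₂₁ (hc₂₁.2.2 _) (hδ₂₂.2.2 _)
        (Bδ₂₂ _).2 (Bc₂₂ _).1 (Bb₂ _).1 (Bδ₂₁ _).1 (Bc₂₁ _).2
        (h.trans (hm₁ _)) (hm₂ _) (U₂ _) Hs₂ dm₂
      rw [← hε₂] at this
      have := (min_le_right ε₁ ε₂).trans_lt this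
      exact ⟨this.trans_le h, this⟩
  intro t
  have a1 := le_max_left (max R₁ R₂) (min ε₁ ε₂)
  have a2 := le_max_left R₁ R₂
  have a3 := le_max_right R₁ R₂
  refine ⟨L.1.trans_le (hm₁ t), ?_, L.2.trans_le (hm₂ t), ?_⟩
  · linarith [U₁ t]
  · linarith [U₂ t]
end

section
/- For every ε > 0 one has g₁(ε,ε) < ε(δ₁₁⁺/c₁₁⁻ − b₁⁻ e^{−ε} − δ₁₂⁻/(c₁₂⁺ + ε)), and for 0 < ε ≤ x₂ one has g₁(ε, x₂) ≤ g₁(ε, ε). -/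
open Real Set

/-- The averaged first component
`g₁(x₁,x₂) = (1/ω) ∫₀^ω (δ₁₁ x₁/(c₁₁+x₁) − b₁ x₁ e^{−x₁} − δ₁₂ x₂/(c₁₂+x₂)) dt`. -/
noncomputable def gOne (ω : ℝ) (δ₁₁ δ₁₂ c₁₁ c₁₂ b₁ : ℝ → ℝ) (x₁ x₂ : ℝ) : ℝ :=
  (1 / ω) * ∫ t in (0:ℝ)..ω,
    (δ₁₁ t * x₁ / (c₁₁ t + x₁) - b₁ t * (x₁ * Real.exp (-x₁))
      - δ₁₂ t * x₂ / (c₁₂ t + x₂))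

/-- The averaged second component
`g₂(x₁,x₂) = (1/ω) ∫₀^ω (δ₂₂ x₂/(c₂₂+x₂) − b₂ x₂ e^{−x₂} − δ₂₁ x₁/(c₂₁+x₁)) dt`. -/
noncomputable def gTwo (ω : ℝ) (δ₂₁ δ₂₂ c₂₁ c₂₂ b₂ : ℝ → ℝ) (x₁ x₂ : ℝ) : ℝ :=
  (1 / ω) * ∫ t in (0:ℝ)..ω,
    (δ₂₂ t * x₂ / (c₂₂ t + x₂) - b₂ t * (x₂ * Real.exp (-x₂))
      - δ₂₁ t * x₁ / (c₂₁ t + x₁))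

theorem NiceCoef.infC_le {ω : ℝ} {g : ℝ → ℝ} (h : NiceCoef ω g) {t : ℝ} (ht : t ∈ Icc 0 ω) :
    infC ω g ≤ g t :=
  csInf_le (isCompact_Icc.image h.1).bddBelow (mem_image_of_mem g ht)

theorem NiceCoef.le_supC {ω : ℝ} {g : ℝ → ℝ} (h : NiceCoef ω g) {t : ℝ} (ht : t ∈ Icc 0 ω) :
    g t ≤ supC ω g :=
  le_csSup (isCompact_Icc.image h.1).bddAbove (mem_image_of_mem g ht)

theorem NiceCoef.infC_pos {ω : ℝ} {g : ℝ → ℝ} (hω : 0 < ω) (h : NiceCoef ω g) :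
    0 < infC ω g := by
  have hne : (g '' Icc 0 ω).Nonempty := ⟨g 0, mem_image_of_mem g ⟨le_rfl, hω.le⟩⟩
  obtain ⟨t, -, ht⟩ := (isCompact_Icc.image h.1).sInf_mem hne
  unfold infC
  rw [← ht]
  exact h.2.2 t

theorem gOne_integrand_continuous {ω : ℝ} {δ₁₁ δ₁₂ c₁₁ c₁₂ b₁ : ℝ → ℝ}
    (hδ₁₁ : NiceCoef ω δ₁₁) (hδ₁₂ : NiceCoef ω δ₁₂)
    (hc₁₁ : NiceCoef ω c₁₁) (hc₁₂ : NiceCoef ω c₁₂) (hb₁ : NiceCoef ω b₁)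
    {x₁ x₂ : ℝ} (h₁ : 0 < x₁) (h₂ : 0 < x₂) :
    Continuous (fun t => δ₁₁ t * x₁ / (c₁₁ t + x₁) - b₁ t * (x₁ * Real.exp (-x₁))
      - δ₁₂ t * x₂ / (c₁₂ t + x₂)) := by
  refine Continuous.sub (Continuous.sub (Continuous.div (hδ₁₁.1.mul continuous_const)
    (hc₁₁.1.add continuous_const) ?_) (hb₁.1.mul continuous_const))
    (Continuous.div (hδ₁₂.1.mul continuous_const) (hc₁₂.1.add continuous_const) ?_)
  · intro t
    have := hc₁₁.2.2 t
    positivity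
  · intro t
    have := hc₁₂.2.2 t
    positivity

/-- Estimates for g₁ near the lower boundary. -/
theorem gOne_lower_estimates
    (ω : ℝ) (hω : 0 < ω)
    (δ₁₁ δ₁₂ δ₂₁ δ₂₂ c₁₁ c₁₂ c₂₁ c₂₂ b₁ b₂ : ℝ → ℝ)
    (hδ₁₁ : NiceCoef ω δ₁₁) (hδ₁₂ : NiceCoef ω δ₁₂)
    (hδ₂₁ : NiceCoef ω δ₂₁) (hδ₂₂ : NiceCoef ω δ₂₂)
    (hc₁₁ : NiceCoef ω c₁₁) (hc₁₂ : NiceCoef ω c₁₂)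
    (hc₂₁ : NiceCoef ω c₂₁) (hc₂₂ : NiceCoef ω c₂₂)
    (hb₁ : NiceCoef ω b₁) (hb₂ : NiceCoef ω b₂) :
    ∀ ε : ℝ, 0 < ε →
      gOne ω δ₁₁ δ₁₂ c₁₁ c₁₂ b₁ ε ε <
        ε * (supC ω δ₁₁ / infC ω c₁₁ - infC ω b₁ * Real.exp (-ε)
              - infC ω δ₁₂ / (supC ω c₁₂ + ε)) ∧
      ∀ x₂ : ℝ, ε ≤ x₂ →
        gOne ω δ₁₁ δ₁₂ c₁₁ c₁₂ b₁ ε x₂ ≤ gOne ω δ₁₁ δ₁₂ c₁₁ c₁₂ b₁ ε ε := by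
  intro ε hε
  have hcont := gOne_integrand_continuous hδ₁₁ hδ₁₂ hc₁₁ hc₁₂ hb₁ hε hε
  refine ⟨?_, ?_⟩
  · set K := ε * (supC ω δ₁₁ / infC ω c₁₁ - infC ω b₁ * Real.exp (-ε)
              - infC ω δ₁₂ / (supC ω c₁₂ + ε)) with hK
    have key : ∀ t ∈ Icc 0 ω, δ₁₁ t * ε / (c₁₁ t + ε) - b₁ t * (ε * Real.exp (-ε))
        - δ₁₂ t * ε / (c₁₂ t + ε) < K := by
      intro t ht
      have p1 := hδ₁₁.2.2 t
      have p2 := hδ₁₂.2.2 t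
      have p3 := hc₁₁.infC_pos hω
      have p4 := hc₁₂.2.2 t
      have q1 : δ₁₁ t * ε / (c₁₁ t + ε) < supC ω δ₁₁ * ε / infC ω c₁₁ := by
        have h1 : δ₁₁ t * ε / (c₁₁ t + ε) < δ₁₁ t * ε / infC ω c₁₁ := by
          apply div_lt_div_of_pos_left (by positivity) p3
          linarith [hc₁₁.infC_le ht]
        have h2 : δ₁₁ t * ε / infC ω c₁₁ ≤ supC ω δ₁₁ * ε / infC ω c₁₁ := by
          have := hδ₁₁.le_supC ht
          gcongr
        exact h1.trans_le h2
      have q2 : infC ω b₁ * (ε * Real.exp (-ε)) ≤ b₁ t * (ε * Real.exp (-ε)) := by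
        have := hb₁.infC_le ht
        gcongr
      have q3 : infC ω δ₁₂ * ε / (supC ω c₁₂ + ε) ≤ δ₁₂ t * ε / (c₁₂ t + ε) := by
        have h1 := hδ₁₂.infC_le ht
        have h2 := hc₁₂.le_supC ht
        gcongr
      have e : K = supC ω δ₁₁ * ε / infC ω c₁₁ - infC ω b₁ * (ε * Real.exp (-ε))
          - infC ω δ₁₂ * ε / (supC ω c₁₂ + ε) := by
        rw [hK]; ring
      rw [e]; linarith
    have hlt := intervalIntegral.integral_lt_integral_of_continuousOn_of_le_of_exists_lt hω
      hcont.continuousOn (continuousOn_const (c := K))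
      (fun t ht => (key t (Ioc_subset_Icc_self ht)).le)
      ⟨0, ⟨le_rfl, hω.le⟩, key 0 ⟨le_rfl, hω.le⟩⟩
    rw [intervalIntegral.integral_const, smul_eq_mul, sub_zero] at hlt
    unfold gOne
    rw [one_div, inv_mul_lt_iff₀ hω]
    exact hlt
  · intro x₂ hx
    have hx₂ : 0 < x₂ := hε.trans_le hx
    unfold gOne
    refine mul_le_mul_of_nonneg_left ?_ (by positivity)
    refine intervalIntegral.integral_mono_on hω.le
      ((gOne_integrand_continuous hδ₁₁ hδ₁₂ hc₁₁ hc₁₂ hb₁ hε hx₂).intervalIntegrable _ _)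
      (hcont.intervalIntegrable _ _) ?_
    intro t _
    have p2 := hδ₁₂.2.2 t
    have p4 := hc₁₂.2.2 t
    have : δ₁₂ t * ε / (c₁₂ t + ε) ≤ δ₁₂ t * x₂ / (c₁₂ t + x₂) := by
      rw [div_le_div_iff₀ (by positivity) (by positivity)]
      nlinarith [mul_le_mul_of_nonneg_left hx (mul_pos p2 p4).le]
    linarith
end

section
/- Assume (H3): δ₁₁⁺/c₁₁⁻ − δ₁₂⁻/c₁₂⁺ < b₁⁻. Then there exists ε₁ > 0 such that for every ε with 0 < ε < ε₁ and every x₂ with ε ≤ x₂, one has g₁(ε, x₂) ≤ g₁(ε, ε) < 0. -/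
open Real Set

lemma NiceCoef.bounds {ω : ℝ} (hω : 0 < ω) {g : ℝ → ℝ} (hg : NiceCoef ω g) :
    0 < infC ω g ∧ 0 < supC ω g ∧ ∀ t ∈ Icc 0 ω, infC ω g ≤ g t ∧ g t ≤ supC ω g := by
  obtain ⟨hc, -, hp⟩ := hg
  have hK : IsCompact (g '' Icc 0 ω) := isCompact_Icc.image hc
  have hne : (g '' Icc 0 ω).Nonempty := ⟨g 0, 0, ⟨le_refl _, hω.le⟩, rfl⟩
  obtain ⟨s, -, hs⟩ := hK.sInf_mem hne
  obtain ⟨r, -, hr⟩ := hK.sSup_mem hne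
  refine ⟨?_, ?_, fun t ht => ⟨?_, ?_⟩⟩
  · unfold infC; rw [← hs]; exact hp s
  · unfold supC; rw [← hr]; exact hp r
  · exact csInf_le hK.bddBelow ⟨t, ht, rfl⟩
  · exact le_csSup hK.bddAbove ⟨t, ht, rfl⟩

lemma gOne_intble (ω : ℝ) {δ₁₁ δ₁₂ c₁₁ c₁₂ b₁ : ℝ → ℝ}
    (hδ₁₁ : NiceCoef ω δ₁₁) (hδ₁₂ : NiceCoef ω δ₁₂)
    (hc₁₁ : NiceCoef ω c₁₁) (hc₁₂ : NiceCoef ω c₁₂) (hb₁ : NiceCoef ω b₁)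
    {x y : ℝ} (hx : 0 < x) (hy : 0 < y) :
    IntervalIntegrable (fun t => δ₁₁ t * x / (c₁₁ t + x) - b₁ t * (x * Real.exp (-x))
      - δ₁₂ t * y / (c₁₂ t + y)) MeasureTheory.volume 0 ω := by
  apply Continuous.intervalIntegrable
  have h1 := hδ₁₁.1
  have h2 := hδ₁₂.1
  have h3 := hc₁₁.1
  have h4 := hc₁₂.1
  have h5 := hb₁.1
  refine ((Continuous.div (by fun_prop) (by fun_prop) fun t => ?_).sub (by fun_prop)).sub
    (Continuous.div (by fun_prop) (by fun_prop) fun t => ?_)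
  · have := hc₁₁.2.2 t
    positivity
  · have := hc₁₂.2.2 t
    positivity

/-- Under (H3), g₁ is negative near the lower boundary. -/
theorem gOne_negative_near_zero
    (ω : ℝ) (hω : 0 < ω)
    (δ₁₁ δ₁₂ δ₂₁ δ₂₂ c₁₁ c₁₂ c₂₁ c₂₂ b₁ b₂ : ℝ → ℝ)
    (hδ₁₁ : NiceCoef ω δ₁₁) (hδ₁₂ : NiceCoef ω δ₁₂)
    (hδ₂₁ : NiceCoef ω δ₂₁) (hδ₂₂ : NiceCoef ω δ₂₂)
    (hc₁₁ : NiceCoef ω c₁₁) (hc₁₂ : NiceCoef ω c₁₂)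
    (hc₂₁ : NiceCoef ω c₂₁) (hc₂₂ : NiceCoef ω c₂₂)
    (hb₁ : NiceCoef ω b₁) (hb₂ : NiceCoef ω b₂)
    (H3 : supC ω δ₁₁ / infC ω c₁₁ - infC ω δ₁₂ / supC ω c₁₂ < infC ω b₁) :
    ∃ ε₁ : ℝ, 0 < ε₁ ∧
      ∀ ε : ℝ, 0 < ε → ε < ε₁ → ∀ x₂ : ℝ, ε ≤ x₂ →
        gOne ω δ₁₁ δ₁₂ c₁₁ c₁₂ b₁ ε x₂ ≤ gOne ω δ₁₁ δ₁₂ c₁₁ c₁₂ b₁ ε ε ∧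
        gOne ω δ₁₁ δ₁₂ c₁₁ c₁₂ b₁ ε ε < 0 := by
  obtain ⟨-, -, hD⟩ := hδ₁₁.bounds hω
  obtain ⟨hd0, -, hd⟩ := hδ₁₂.bounds hω
  obtain ⟨hC0, -, hC⟩ := hc₁₁.bounds hω
  obtain ⟨-, hK0, hK⟩ := hc₁₂.bounds hω
  obtain ⟨-, -, hB⟩ := hb₁.bounds hω
  generalize supC ω δ₁₁ = D at *
  generalize infC ω δ₁₂ = d at *
  generalize infC ω c₁₁ = C at *
  generalize supC ω c₁₂ = K at *
  generalize infC ω b₁ = B at *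
  have hcont : ContinuousAt (fun e : ℝ => D / C - B * Real.exp (-e) - d / (K + e)) 0 := by
    refine ContinuousAt.sub (by fun_prop) (ContinuousAt.div (by fun_prop) (by fun_prop) ?_)
    simpa using hK0.ne'
  have hev := hcont.eventually_lt_const (u := 0) (by simp; linarith)
  obtain ⟨ε₁, h0, hball⟩ := Metric.eventually_nhds_iff.1 hev
  refine ⟨ε₁, h0, fun ε hε hε1 x₂ hx => ?_⟩
  have hx0 : 0 < x₂ := hε.trans_le hx
  have hφ := hball (y := ε) (by simpa [abs_of_pos hε] using hε1)
  have hI := gOne_intble ω hδ₁₁ hδ₁₂ hc₁₁ hc₁₂ hb₁ hε hε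
  have hω' : 0 < 1 / ω := by positivity
  constructor
  · unfold gOne
    refine mul_le_mul_of_nonneg_left ?_ hω'.le
    refine intervalIntegral.integral_mono_on hω.le
      (gOne_intble ω hδ₁₁ hδ₁₂ hc₁₁ hc₁₂ hb₁ hε hx0) hI fun t _ => ?_
    have h1 := hc₁₂.2.2 t
    have h2 := hδ₁₂.2.2 t
    have : δ₁₂ t * ε / (c₁₂ t + ε) ≤ δ₁₂ t * x₂ / (c₁₂ t + x₂) := by
      rw [div_le_div_iff₀ (by positivity) (by positivity)]
      nlinarith [mul_le_mul_of_nonneg_left hx (mul_pos h2 h1).le]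
    linarith
  · unfold gOne
    refine mul_neg_of_pos_of_neg hω' ?_
    refine lt_of_le_of_lt (intervalIntegral.integral_mono_on hω.le hI
      (g := fun _ => ε * (D / C - B * Real.exp (-ε) - d / (K + ε)))
      intervalIntegrable_const fun t ht => ?_) ?_
    · have h1 := hc₁₂.2.2 t
      have h2 := hδ₁₂.2.2 t
      have h3 := hδ₁₁.2.2 t
      have e1 : δ₁₁ t / (c₁₁ t + ε) ≤ D / C :=
        div_le_div₀ (h3.le.trans (hD t ht).2) (hD t ht).2 hC0 (by linarith [(hC t ht).1])
      have e2 : d / (K + ε) ≤ δ₁₂ t / (c₁₂ t + ε) :=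
        div_le_div₀ h2.le (hd t ht).1 (by positivity) (by linarith [(hK t ht).2])
      have e3 : B * Real.exp (-ε) ≤ b₁ t * Real.exp (-ε) :=
        mul_le_mul_of_nonneg_right (hB t ht).1 (Real.exp_pos _).le
      calc _ = ε * (δ₁₁ t / (c₁₁ t + ε) - b₁ t * Real.exp (-ε) - δ₁₂ t / (c₁₂ t + ε)) := by ring
        _ ≤ _ := mul_le_mul_of_nonneg_left (by linarith) hε.le
    · rw [intervalIntegral.integral_const, smul_eq_mul, sub_zero]
      exact mul_neg_of_pos_of_neg hω (mul_neg_of_pos_of_neg hε hφ)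
end
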